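/- For every type σ, the term Pcase([], σ) built recursively from the parallel conjunction and = λxy. pcase x y 1 together with the sequential constants (using the fixed point combinator Y at recursive types) has the same denotational semantics as the parallel conditional constant: ⟦Pcase([], σ)⟧⊥ = ⟦pcase_σ⟧⊥, where pcase_σ : bool → σ → σ → σ. Hence the parallel case function at every type is definable from the parallel and-function and the sequential constants. -/

import Mathlib

set_option autoImplicit false

namespace RecLam

/-- Type expressions: type variables, separated sum, product, function space,
recursion `μt.τ`, and `void`. -/
inductive TyExpr : Type where
  | tvar : ℕ → TyExpr
  | sum : TyExpr → TyExpr → TyExpr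
  | prod : TyExpr → TyExpr → TyExpr
  | arrow : TyExpr → TyExpr → TyExpr
  | mu : ℕ → TyExpr → TyExpr
  | void : TyExpr
  deriving DecidableEq

namespace TyExpr

/-- Free type variables of a type expression. -/
def freeTV : TyExpr → Finset ℕ
  | .tvar t => {t}
  | .sum a b => freeTV a ∪ freeTV b
  | .prod a b => freeTV a ∪ freeTV b
  | .arrow a b => freeTV a ∪ freeTV b
  | .mu t a => (freeTV a).erase t
  | .void => ∅

/-- A type expression is closed (a *type*) iff it has no free type variables. -/
def Closed (τ : TyExpr) : Prop := freeTV τ = ∅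

/-- `substTy σ t ρ` is `σ[ρ/t]`, substitution of `ρ` for the free occurrences of `t`. -/
def substTy : TyExpr → ℕ → TyExpr → TyExpr
  | .tvar s, t, ρ => if s = t then ρ else .tvar s
  | .sum a b, t, ρ => .sum (substTy a t ρ) (substTy b t ρ)
  | .prod a b, t, ρ => .prod (substTy a t ρ) (substTy b t ρ)
  | .arrow a b, t, ρ => .arrow (substTy a t ρ) (substTy b t ρ)
  | .mu s a, t, ρ => if s = t then .mu s a else .mu s (substTy a t ρ)
  | .void, _, _ => .void

end TyExpr

/-- One-step unfolding `↝` of an outermost `μ`-redex. -/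
inductive Unfold : TyExpr → TyExpr → Prop
  | mu (t : ℕ) (a : TyExpr) : Unfold (.mu t a) (TyExpr.substTy a t (.mu t a))
  | sumL {a a' : TyExpr} (b : TyExpr) : Unfold a a' → Unfold (.sum a b) (.sum a' b)
  | sumR (a : TyExpr) {b b' : TyExpr} : Unfold b b' → Unfold (.sum a b) (.sum a b')
  | prodL {a a' : TyExpr} (b : TyExpr) : Unfold a a' → Unfold (.prod a b) (.prod a' b)
  | prodR (a : TyExpr) {b b' : TyExpr} : Unfold b b' → Unfold (.prod a b) (.prod a b')
  | arrowL {a a' : TyExpr} (b : TyExpr) : Unfold a a' → Unfold (.arrow a b) (.arrow a' b)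
  | arrowR (a : TyExpr) {b b' : TyExpr} : Unfold b b' → Unfold (.arrow a b) (.arrow a b')

/-- `↝*`, the reflexive transitive closure of one-step unfolding. -/
def Unfolds : TyExpr → TyExpr → Prop := Relation.ReflTransGen Unfold

/-- The `void`-prefix order `σ ≼ τ`: the least relation with `void ≼ τ` for all `τ`
and compatible with the constructors `+`, `×`, `→`.  Its left-hand sides are
exactly the simple types. -/
inductive Pre : TyExpr → TyExpr → Prop
  | void (τ : TyExpr) : Pre .void τ
  | sum {s s' t t' : TyExpr} : Pre s s' → Pre t t' → Pre (.sum s t) (.sum s' t')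
  | prod {s s' t t' : TyExpr} : Pre s s' → Pre t t' → Pre (.prod s t) (.prod s' t')
  | arrow {s s' t t' : TyExpr} : Pre s s' → Pre t t' → Pre (.arrow s t) (.arrow s' t')

/-- The unfolding `τ* = { σ ∈ T ∣ ∃ τ'. τ ↝* τ' ∧ σ ≼ τ' }` of a type `τ`. -/
def unfolding (τ : TyExpr) : Set TyExpr := {σ | ∃ τ', Unfolds τ τ' ∧ Pre σ τ'}

/-- Two types are equivalent iff they have the same unfolding as (regular) trees. -/
def TyEquiv (σ τ : TyExpr) : Prop := unfolding σ = unfolding τ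

end RecLam

namespace RecLam

/-- The constants of the calculus, with their type subscripts. -/
inductive Const : Type where
  | czero : TyExpr → TyExpr → Const      -- 0_{σ,τ} : σ → (σ+τ)   ("inleft")
  | cone : TyExpr → TyExpr → Const       -- 1_{σ,τ} : τ → (σ+τ)   ("inright")
  | ccase : TyExpr → TyExpr → TyExpr → Const   -- case_{σ,τ,ρ}
  | cpcase : TyExpr → TyExpr → TyExpr → Const  -- pcase_{σ,τ,ρ}
  | cpair : TyExpr → TyExpr → Const      -- pair_{σ,τ}
  | cfst : TyExpr → TyExpr → Const       -- fst_{σ,τ}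
  | csnd : TyExpr → TyExpr → Const       -- snd_{σ,τ}
  | comega : TyExpr → Const              -- Ω_σ
  deriving DecidableEq

/-- The type of each constant. -/
def constType : Const → TyExpr
  | .czero σ τ => .arrow σ (.sum σ τ)
  | .cone σ τ => .arrow τ (.sum σ τ)
  | .ccase σ τ ρ => .arrow (.sum σ τ) (.arrow (.arrow σ ρ) (.arrow (.arrow τ ρ) ρ))
  | .cpcase σ τ ρ => .arrow (.sum σ τ) (.arrow ρ (.arrow ρ ρ))
  | .cpair σ τ => .arrow σ (.arrow τ (.prod σ τ))
  | .cfst σ τ => .arrow (.prod σ τ) σ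
  | .csnd σ τ => .arrow (.prod σ τ) τ
  | .comega σ => σ

/-- Terms, in de Bruijn representation (so terms are identified up to α-conversion):
variables, constants, application and λ-abstraction (the binder carries the type of
the abstracted variable). -/
inductive Tm : Type where
  | var : ℕ → Tm
  | const : Const → Tm
  | app : Tm → Tm → Tm
  | lam : TyExpr → Tm → Tm
  deriving DecidableEq

/-- Lift (shift) the de Bruijn variables `≥ d` by one. -/
def liftTm (d : ℕ) : Tm → Tm
  | .var n => if n < d then .var n else .var (n + 1)
  | .const c => .const c
  | .app M N => .app (liftTm d M) (liftTm d N)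
  | .lam σ M => .lam σ (liftTm (d + 1) M)

/-- Capture-avoiding substitution `M[k := N]` (de Bruijn). -/
def substTm : Tm → ℕ → Tm → Tm
  | .var n, k, N => if n = k then N else if k < n then .var (n - 1) else .var n
  | .const c, _, _ => .const c
  | .app M P, k, N => .app (substTm M k N) (substTm P k N)
  | .lam σ M, k, N => .lam σ (substTm M (k + 1) (liftTm 0 N))

/-- The typing relation.  A context is a list of types of the free de Bruijn
variables.  It includes the rule (≈): a term of a type `σ` also has every type
equivalent to `σ`. -/
inductive HasType : List TyExpr → Tm → TyExpr → Prop
  | var {Γ : List TyExpr} {n : ℕ} {σ : TyExpr} :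
      Γ[n]? = some σ → HasType Γ (.var n) σ
  | const {Γ : List TyExpr} (c : Const) : HasType Γ (.const c) (constType c)
  | app {Γ : List TyExpr} {M N : Tm} {σ τ : TyExpr} :
      HasType Γ M (.arrow σ τ) → HasType Γ N σ → HasType Γ (.app M N) τ
  | lam {Γ : List TyExpr} {M : Tm} {σ τ : TyExpr} :
      HasType (σ :: Γ) M τ → HasType Γ (.lam σ M) (.arrow σ τ)
  | equiv {Γ : List TyExpr} {M : Tm} {σ τ : TyExpr} :
      HasType Γ M σ → TyEquiv σ τ → HasType Γ M τ

/-- One-step reduction: β-reduction, the ten rewrite rules for the constants,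
closed under arbitrary contexts. -/
inductive Step : Tm → Tm → Prop
  | beta (σ : TyExpr) (M N : Tm) :
      Step (.app (.lam σ M) N) (substTm M 0 N)
  | caseZero (σ τ ρ σ' τ' : TyExpr) (x y z : Tm) :
      Step (.app (.app (.app (.const (.ccase σ τ ρ)) (.app (.const (.czero σ' τ')) x)) y) z)
        (.app y x)
  | caseOne (σ τ ρ σ' τ' : TyExpr) (x y z : Tm) :
      Step (.app (.app (.app (.const (.ccase σ τ ρ)) (.app (.const (.cone σ' τ')) x)) y) z)
        (.app z x)
  | fstPair (σ τ σ' τ' : TyExpr) (x y : Tm) :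
      Step (.app (.const (.cfst σ τ)) (.app (.app (.const (.cpair σ' τ')) x) y)) x
  | sndPair (σ τ σ' τ' : TyExpr) (x y : Tm) :
      Step (.app (.const (.csnd σ τ)) (.app (.app (.const (.cpair σ' τ')) x) y)) y
  | pcaseZero (σ τ ρ σ' τ' : TyExpr) (x y z : Tm) :
      Step (.app (.app (.app (.const (.cpcase σ τ ρ)) (.app (.const (.czero σ' τ')) x)) y) z) y
  | pcaseOne (σ τ ρ σ' τ' : TyExpr) (x y z : Tm) :
      Step (.app (.app (.app (.const (.cpcase σ τ ρ)) (.app (.const (.cone σ' τ')) x)) y) z) z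
  | pcaseZZ (σ τ ρ₀ ρ₁ σ₁ τ₁ σ₂ τ₂ : TyExpr) (x y z : Tm) :
      Step (.app (.app (.app (.const (.cpcase σ τ (.sum ρ₀ ρ₁))) x)
              (.app (.const (.czero σ₁ τ₁)) y)) (.app (.const (.czero σ₂ τ₂)) z))
        (.app (.const (.czero ρ₀ ρ₁)) (.app (.app (.app (.const (.cpcase σ τ ρ₀)) x) y) z))
  | pcaseOO (σ τ ρ₀ ρ₁ σ₁ τ₁ σ₂ τ₂ : TyExpr) (x y z : Tm) :
      Step (.app (.app (.app (.const (.cpcase σ τ (.sum ρ₀ ρ₁))) x)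
              (.app (.const (.cone σ₁ τ₁)) y)) (.app (.const (.cone σ₂ τ₂)) z))
        (.app (.const (.cone ρ₀ ρ₁)) (.app (.app (.app (.const (.cpcase σ τ ρ₁)) x) y) z))
  | pcasePair (σ τ ρ₁ ρ₂ σ₁ τ₁ σ₂ τ₂ : TyExpr) (x y₁ y₂ z₁ z₂ : Tm) :
      Step (.app (.app (.app (.const (.cpcase σ τ (.prod ρ₁ ρ₂))) x)
              (.app (.app (.const (.cpair σ₁ τ₁)) y₁) y₂))
              (.app (.app (.const (.cpair σ₂ τ₂)) z₁) z₂))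
        (.app (.app (.const (.cpair ρ₁ ρ₂))
            (.app (.app (.app (.const (.cpcase σ τ ρ₁)) x) y₁) z₁))
          (.app (.app (.app (.const (.cpcase σ τ ρ₂)) x) y₂) z₂))
  | pcaseArrow (σ τ ρ₁ ρ₂ : TyExpr) (x y z w : Tm) :
      Step (.app (.app (.app (.app (.const (.cpcase σ τ (.arrow ρ₁ ρ₂))) x) y) z) w)
        (.app (.app (.app (.const (.cpcase σ τ ρ₂)) x) (.app y w)) (.app z w))
  | appL {M M' : Tm} (N : Tm) : Step M M' → Step (.app M N) (.app M' N)
  | appR (M : Tm) {N N' : Tm} : Step N N' → Step (.app M N) (.app M N')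
  | lamC (σ : TyExpr) {M M' : Tm} : Step M M' → Step (.lam σ M) (.lam σ M')

/-- `→*`, the reflexive transitive closure of one-step reduction. -/
def Steps : Tm → Tm → Prop := Relation.ReflTransGen Step

end RecLam

namespace RecLam

/-- The universe of primes for the prime-system interpretation of types:
`stag b` is the atom `b ∈ {0,1}` of a separated sum, `spr b a` is the pair `(b,a)`
of a separated sum, `ppr b a` is the pair `(b,a)` of a product, and `fn X a`
is the prime `(X, a)` of a function space (the finite set `X` is represented
as a list). -/
inductive Pm : Type where
  | stag : Bool → Pm
  | spr : Bool → Pm → Pm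
  | ppr : Bool → Pm → Pm
  | fn : List Pm → Pm → Pm

/-- The data of a prime system on the universe `Pm`. -/
structure PData where
  carrier : Set Pm
  con : Pm → Pm → Prop
  le : Pm → Pm → Prop

/-- The elements of a prime system: downward closed, pairwise consistent subsets
of the prime set. -/
def PData.IsElem (A : PData) (d : Set Pm) : Prop :=
  d ⊆ A.carrier ∧ (∀ a b : Pm, A.le a b → b ∈ d → a ∈ d) ∧ ∀ a ∈ d, ∀ b ∈ d, A.con a b

/-- The prime system of the type `void`: no primes. -/
def voidP : PData := ⟨∅, fun _ _ => False, fun _ _ => False⟩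

/-- One side `{b} ∪ ({b} × A)` of a separated sum. -/
def sumSideP (A : PData) (b : Bool) : Set Pm :=
  {p | p = .stag b ∨ ∃ a ∈ A.carrier, p = .spr b a}

/-- The separated sum of prime systems. -/
def sumP (A B : PData) : PData where
  carrier := sumSideP A false ∪ sumSideP B true
  con x y :=
    (x ∈ sumSideP A false ∧ y ∈ sumSideP A false ∧
      ∀ a b, x = .spr false a → y = .spr false b → A.con a b) ∨
    (x ∈ sumSideP B true ∧ y ∈ sumSideP B true ∧
      ∀ a b, x = .spr true a → y = .spr true b → B.con a b)
  le x y :=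
    (x = .stag false ∧ y ∈ sumSideP A false) ∨
    (x = .stag true ∧ y ∈ sumSideP B true) ∨
    (∃ a b, x = .spr false a ∧ y = .spr false b ∧ A.le a b) ∨
    (∃ a b, x = .spr true a ∧ y = .spr true b ∧ B.le a b)

/-- The cartesian product of prime systems. -/
def prodP (A B : PData) : PData where
  carrier := {p | (∃ a ∈ A.carrier, p = .ppr false a) ∨ ∃ b ∈ B.carrier, p = .ppr true b}
  con x y :=
    (∃ a b, x = .ppr false a ∧ y = .ppr false b ∧ A.con a b) ∨
    (∃ a b, x = .ppr true a ∧ y = .ppr true b ∧ B.con a b) ∨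
    (∃ a b, x = .ppr false a ∧ y = .ppr true b ∧ a ∈ A.carrier ∧ b ∈ B.carrier) ∨
    (∃ a b, x = .ppr true a ∧ y = .ppr false b ∧ a ∈ B.carrier ∧ b ∈ A.carrier)
  le x y :=
    (∃ a b, x = .ppr false a ∧ y = .ppr false b ∧ A.le a b) ∨
    (∃ a b, x = .ppr true a ∧ y = .ppr true b ∧ B.le a b)

/-- `X ∈ Ā`: the (finite) list `X` consists of primes of `A` that are pairwise
consistent and pairwise incomparable. -/
def goodList (A : PData) (X : List Pm) : Prop :=
  (∀ x ∈ X, x ∈ A.carrier) ∧ ∀ x ∈ X, ∀ y ∈ X, A.con x y ∧ (A.le x y → x = y)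

/-- The function-space prime system `A → B`. -/
def funcP (A B : PData) : PData where
  carrier := {p | ∃ X a, p = .fn X a ∧ goodList A X ∧ a ∈ B.carrier}
  con x y := ∃ X a Y b, x = .fn X a ∧ y = .fn Y b ∧
    goodList A X ∧ a ∈ B.carrier ∧ goodList A Y ∧ b ∈ B.carrier ∧
    ((∀ u ∈ X, ∀ v ∈ Y, A.con u v) → B.con a b)
  le x y := ∃ X a Y b, x = .fn X a ∧ y = .fn Y b ∧
    goodList A X ∧ a ∈ B.carrier ∧ goodList A Y ∧ b ∈ B.carrier ∧
    (∀ v ∈ Y, ∃ u ∈ X, A.le v u) ∧ B.le a b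

/-- Interpretation of simple types as prime systems. -/
def interpSimple : TyExpr → PData
  | .void => voidP
  | .tvar _ => voidP
  | .mu _ _ => voidP
  | .sum a b => sumP (interpSimple a) (interpSimple b)
  | .prod a b => prodP (interpSimple a) (interpSimple b)
  | .arrow a b => funcP (interpSimple a) (interpSimple b)

/-- The prime-system interpretation `P(τ*)` of a type `τ`: the lub (union) of the
interpretations of the simple prefixes of the unfoldings of `τ` (this directed
union equals the lub of the chain of finite approximations of the type tree
`τ*`). -/
def tyInterp (τ : TyExpr) : PData where
  carrier := {p | ∃ σ ∈ unfolding τ, p ∈ (interpSimple σ).carrier}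
  con x y := ∃ σ ∈ unfolding τ, (interpSimple σ).con x y
  le x y := ∃ σ ∈ unfolding τ, (interpSimple σ).le x y

/-- Application `|r|(d)` of (the function associated with) a set `r` of
function-space primes to a set `d` of primes. -/
def aps (r d : Set Pm) : Set Pm :=
  {b | ∃ X : List Pm, (∀ x ∈ X, x ∈ d) ∧ Pm.fn X b ∈ r}

/-- The downward closure `↓X` of a finite set (list) of primes in `A`. -/
def downListP (A : PData) (X : List Pm) : Set Pm := {a | ∃ x ∈ X, A.le a x}

/-- `Pr(f) = {(X, a) ∣ X ∈ Ā ∧ a ∈ f(↓X)}`, the element of a function-space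
prime system associated with a function `f` (on sets of primes of `A`). -/
def PrOf (A : PData) (f : Set Pm → Set Pm) : Set Pm :=
  {p | ∃ X a, p = Pm.fn X a ∧ goodList A X ∧ a ∈ f (downListP A X)}

/-- Semantic injection `0`: `d ↦ {0} ∪ ({0} × d)`. -/
def inj0 (d : Set Pm) : Set Pm := {p | p = .stag false ∨ ∃ a ∈ d, p = .spr false a}

/-- Semantic injection `1`: `d ↦ {1} ∪ ({1} × d)`. -/
def inj1 (d : Set Pm) : Set Pm := {p | p = .stag true ∨ ∃ a ∈ d, p = .spr true a}

/-- Semantic pairing: `(d, e) ↦ ({0} × d) ∪ ({1} × e)`. -/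
def pairS (d e : Set Pm) : Set Pm :=
  {p | (∃ a ∈ d, p = .ppr false a) ∨ ∃ b ∈ e, p = .ppr true b}

/-- First projection. -/
def fstS (d : Set Pm) : Set Pm := {a | Pm.ppr false a ∈ d}

/-- Second projection. -/
def sndS (d : Set Pm) : Set Pm := {a | Pm.ppr true a ∈ d}

/-- The component `e` of a sum element `0e` (resp. `1e`). -/
def prj0 (d : Set Pm) : Set Pm := {a | Pm.spr false a ∈ d}
def prj1 (d : Set Pm) : Set Pm := {a | Pm.spr true a ∈ d}

/-- The (strict) `case` function: `⊥` if `d = ⊥`, `|f|e` if `d = 0e`,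
`|g|e` if `d = 1e`. -/
def caseS (d f g : Set Pm) : Set Pm :=
  {b | (Pm.stag false ∈ d ∧ b ∈ aps f (prj0 d)) ∨ (Pm.stag true ∈ d ∧ b ∈ aps g (prj1 d))}

/-- The parallel `pcase` function: `b ∩ c` if `a = ⊥`, `b` if `a = 0a'`,
`c` if `a = 1a'`. -/
def pcaseS (a b c : Set Pm) : Set Pm :=
  {p | (Pm.stag false ∉ a ∧ Pm.stag true ∉ a ∧ p ∈ b ∩ c) ∨
       (Pm.stag false ∈ a ∧ p ∈ b) ∨ (Pm.stag true ∈ a ∧ p ∈ c)}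

/-- The semantics of the constants (the semantic functions are transported into
the domains by `Pr` and its curried variants). -/
def constSem : Const → Set Pm
  | .czero σ _ => PrOf (tyInterp σ) inj0
  | .cone _ τ => PrOf (tyInterp τ) inj1
  | .ccase σ τ ρ =>
      PrOf (tyInterp (.sum σ τ)) fun d =>
        PrOf (tyInterp (.arrow σ ρ)) fun f =>
          PrOf (tyInterp (.arrow τ ρ)) fun g => caseS d f g
  | .cpcase σ τ ρ =>
      PrOf (tyInterp (.sum σ τ)) fun a =>
        PrOf (tyInterp ρ) fun b =>
          PrOf (tyInterp ρ) fun c => pcaseS a b c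
  | .cpair σ τ =>
      PrOf (tyInterp σ) fun d => PrOf (tyInterp τ) fun e => pairS d e
  | .cfst σ τ => PrOf (tyInterp (.prod σ τ)) fstS
  | .csnd σ τ => PrOf (tyInterp (.prod σ τ)) sndS
  | .comega _ => ∅

/-- Environments assign a domain element (a set of primes) to every de Bruijn
variable. -/
def Env : Type := ℕ → Set Pm

/-- Extend an environment by a value for the variable `0` (de Bruijn cons). -/
def envCons (d : Set Pm) (ε : Env) : Env :=
  fun n => match n with
  | 0 => d
  | n + 1 => ε n

/-- The denotational semantics `⟦M⟧ε` of a term. -/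
def sem : Tm → Env → Set Pm
  | .var n, ε => ε n
  | .const c, _ => constSem c
  | .app M N, ε => aps (sem M ε) (sem N ε)
  | .lam σ M, ε => PrOf (tyInterp σ) fun d => sem M (envCons d ε)

/-- An environment is typed by a context `Γ` iff it maps each variable to an
element of the domain of its type. -/
def GoodEnv (Γ : List TyExpr) (ε : Env) : Prop :=
  ∀ (n : ℕ) (σ : TyExpr), Γ[n]? = some σ → (tyInterp σ).IsElem (ε n)

/-- The environment assigning `⊥ = ∅` to every variable. -/
def botEnv : Env := fun _ => ∅

end RecLam

namespace RecLam

/-- The type `bool = void + void`. -/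
def boolTy : TyExpr := .sum .void .void

/-- The boolean value `0` (true), i.e. the term `0Ω : bool`. -/
def zeroV : Tm := .app (.const (.czero .void .void)) (.const (.comega .void))

/-- The boolean value `1` (false), i.e. the term `1Ω : bool`. -/
def oneV : Tm := .app (.const (.cone .void .void)) (.const (.comega .void))

/-- Ternary application. -/
def app3 (f a b c : Tm) : Tm := .app (.app (.app f a) b) c

/-- `ifz = λxyz. case x (λw.y) (λw.z) : bool → σ → σ → σ`. -/
def ifzTm (σ : TyExpr) : Tm :=
  .lam boolTy (.lam σ (.lam σ
    (app3 (.const (.ccase .void .void σ)) (.var 2) (.lam .void (.var 2)) (.lam .void (.var 1)))))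

/-- `not = λx. ifz x 1 0 : bool → bool`. -/
def notTm : Tm := .lam boolTy (app3 (ifzTm boolTy) (.var 0) oneV zeroV)

/-- The parallel conjunction `and = λxy. pcase x y 1 : bool → bool → bool`. -/
def andTm : Tm :=
  .lam boolTy (.lam boolTy
    (app3 (.const (.cpcase .void .void boolTy)) (.var 1) (.var 0) oneV))

/-- The parallel disjunction `or = λxy. not (and (not x) (not y))`. -/
def orTm : Tm := .lam boolTy (.lam boolTy
  (.app notTm (.app (.app andTm (.app notTm (.var 1))) (.app notTm (.var 0)))))

/-- `pc = λxyz. or (or (and x y) (and (not x) z)) (and y z) : bool → bool → bool → bool`;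
it has the same semantics as `pcase_bool`. -/
def pcTm : Tm := .lam boolTy (.lam boolTy (.lam boolTy
  (.app (.app orTm
      (.app (.app orTm (.app (.app andTm (.var 2)) (.var 1)))
        (.app (.app andTm (.app notTm (.var 2))) (.var 0))))
    (.app (.app andTm (.var 1)) (.var 0)))))

/-- `sb = λx. case x (λy.0) (λy.1) : (τ+ρ) → bool`. -/
def sbTm (τ ρ : TyExpr) : Tm :=
  .lam (.sum τ ρ) (app3 (.const (.ccase τ ρ boolTy)) (.var 0) (.lam τ zeroV) (.lam ρ oneV))

/-- `out0 = λx. case x (λy.y) Ω : (σ+τ) → σ`. -/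
def out0Tm (σ τ : TyExpr) : Tm :=
  .lam (.sum σ τ)
    (app3 (.const (.ccase σ τ σ)) (.var 0) (.lam σ (.var 0)) (.const (.comega (.arrow τ σ))))

/-- `out1 = λx. case x Ω (λy.y) : (σ+τ) → τ`. -/
def out1Tm (σ τ : TyExpr) : Tm :=
  .lam (.sum σ τ)
    (app3 (.const (.ccase σ τ τ)) (.var 0) (.const (.comega (.arrow σ τ))) (.lam τ (.var 0)))

/-- A type variable not free in `σ`. -/
def freshTV (σ : TyExpr) : ℕ := (TyExpr.freeTV σ).sup id + 1

/-- The fixed point combinator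
`Y_σ = λy^{σ→σ}. (λx^{μt.(t→σ)}. y (x x)) (λx^{μt.(t→σ)}. y (x x)) : (σ→σ)→σ`. -/
def YTm (σ : TyExpr) : Tm :=
  let t := freshTV σ
  let W : Tm := .lam (.mu t (.arrow (.tvar t) σ)) (.app (.var 1) (.app (.var 0) (.var 0)))
  .lam (.arrow σ σ) (.app W W)

/-- Substitute the partial map `θ` for the free type variables of a type expression. -/
def substAllTy (θ : ℕ → Option TyExpr) : TyExpr → TyExpr
  | .tvar t => (θ t).getD (.tvar t)
  | .sum a b => .sum (substAllTy θ a) (substAllTy θ b)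
  | .prod a b => .prod (substAllTy θ a) (substAllTy θ b)
  | .arrow a b => .arrow (substAllTy θ a) (substAllTy θ b)
  | .mu t a => .mu t (substAllTy (fun s => if s = t then none else θ s) a)
  | .void => .void

/-- Shift the term-variable indices of a partial map by `k` (used when moving
under `k` λ-binders). -/
def shiftV (θ : ℕ → Option ℕ) (k : ℕ) : ℕ → Option ℕ := fun t => (θ t).map (· + k)

/-- The recursive construction `Pcase(θ, σ)` of a term for the parallel
conditional at type `σ` from the parallel conjunction `and` and the sequential
constants.  `θv` gives the de Bruijn index of the term variable `p` associated
with each `μ`-bound type variable, and `θt` its associated type. -/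
def PcaseTm : (ℕ → Option ℕ) → (ℕ → Option TyExpr) → TyExpr → Tm
  | θv, _, .tvar t =>
    match θv t with
    | some n => .var n
    | none => .const (.comega (.arrow boolTy (.arrow .void (.arrow .void .void))))
  | θv, θt, .sum τ ρ =>
    let Tτ := substAllTy θt τ
    let Tρ := substAllTy θt ρ
    .lam boolTy (.lam (.sum Tτ Tρ) (.lam (.sum Tτ Tρ)
      (app3 (ifzTm (.sum Tτ Tρ))
        (app3 pcTm (.var 2) (.app (sbTm Tτ Tρ) (.var 1)) (.app (sbTm Tτ Tρ) (.var 0)))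
        (.app (.const (.czero Tτ Tρ))
          (app3 (PcaseTm (shiftV θv 3) θt τ) (.var 2)
            (.app (out0Tm Tτ Tρ) (.var 1)) (.app (out0Tm Tτ Tρ) (.var 0))))
        (.app (.const (.cone Tτ Tρ))
          (app3 (PcaseTm (shiftV θv 3) θt ρ) (.var 2)
            (.app (out1Tm Tτ Tρ) (.var 1)) (.app (out1Tm Tτ Tρ) (.var 0)))))))
  | θv, θt, .prod τ ρ =>
    let Tτ := substAllTy θt τ
    let Tρ := substAllTy θt ρ
    .lam boolTy (.lam (.prod Tτ Tρ) (.lam (.prod Tτ Tρ)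
      (.app (.app (.const (.cpair Tτ Tρ))
          (app3 (PcaseTm (shiftV θv 3) θt τ) (.var 2)
            (.app (.const (.cfst Tτ Tρ)) (.var 1)) (.app (.const (.cfst Tτ Tρ)) (.var 0))))
        (app3 (PcaseTm (shiftV θv 3) θt ρ) (.var 2)
          (.app (.const (.csnd Tτ Tρ)) (.var 1)) (.app (.const (.csnd Tτ Tρ)) (.var 0))))))
  | θv, θt, .arrow τ ρ =>
    let Tτ := substAllTy θt τ
    let Tρ := substAllTy θt ρ
    .lam boolTy (.lam (.arrow Tτ Tρ) (.lam (.arrow Tτ Tρ) (.lam Tτ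
      (app3 (PcaseTm (shiftV θv 4) θt ρ) (.var 3)
        (.app (.var 2) (.var 0)) (.app (.var 1) (.var 0))))))
  | θv, θt, .mu t τ =>
    let T := substAllTy θt (.mu t τ)
    let π := TyExpr.arrow boolTy (.arrow T (.arrow T T))
    .app (YTm π) (.lam π
      (PcaseTm (fun s => if s = t then some 0 else shiftV θv 1 s)
        (fun s => if s = t then some T else θt s) τ))
  | _, _, .void => .const (.comega (.arrow boolTy (.arrow .void (.arrow .void .void))))

/-! ### Prime systems -/

structure PS (A : PData) : Prop where
  le_refl : ∀ x ∈ A.carrier, A.le x x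
  le_trans : ∀ x y z, A.le x y → A.le y z → A.le x z
  le_l : ∀ x y, A.le x y → x ∈ A.carrier
  le_r : ∀ x y, A.le x y → y ∈ A.carrier
  con_l : ∀ x y, A.con x y → x ∈ A.carrier
  con_r : ∀ x y, A.con x y → y ∈ A.carrier
  con_refl : ∀ x ∈ A.carrier, A.con x x
  con_symm : ∀ x y, A.con x y → A.con y x
  con_down : ∀ x x' y, A.le x x' → A.con x' y → A.con x y

structure Sub (A B : PData) : Prop where
  carrier : ∀ x, x ∈ A.carrier → x ∈ B.carrier
  con : ∀ x y, A.con x y ↔ x ∈ A.carrier ∧ y ∈ A.carrier ∧ B.con x y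
  le : ∀ x y, A.le x y ↔ x ∈ A.carrier ∧ y ∈ A.carrier ∧ B.le x y

theorem PS_void : PS voidP := by
  constructor <;> simp [voidP]

theorem mem_sumP {A B : PData} {p : Pm} : p ∈ (sumP A B).carrier ↔
    p = .stag false ∨ (∃ a ∈ A.carrier, p = .spr false a) ∨ p = .stag true ∨
      ∃ a ∈ B.carrier, p = .spr true a := by
  simp [sumP, sumSideP, or_assoc]

theorem PS_sum {A B : PData} (hA : PS A) (hB : PS B) : PS (sumP A B) := by
  obtain ⟨a1, a2, a3, a4, a5, a6, a7, a8, a9⟩ := hA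
  obtain ⟨b1, b2, b3, b4, b5, b6, b7, b8, b9⟩ := hB
  constructor
  · intro x hx; rw [mem_sumP] at hx
    simp only [sumP, sumSideP, Set.mem_ofPred_eq]; grind
  · intro x y z; simp only [sumP, sumSideP, Set.mem_ofPred_eq]; grind
  · intro x y; rw [mem_sumP]; simp only [sumP, sumSideP, Set.mem_ofPred_eq]; grind
  · intro x y; rw [mem_sumP]; simp only [sumP, sumSideP, Set.mem_ofPred_eq]; grind
  · intro x y; rw [mem_sumP]; simp only [sumP, sumSideP, Set.mem_ofPred_eq]; grind
  · intro x y; rw [mem_sumP]; simp only [sumP, sumSideP, Set.mem_ofPred_eq]; grind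
  · intro x hx; rw [mem_sumP] at hx
    simp only [sumP, sumSideP, Set.mem_ofPred_eq]; grind
  · intro x y; simp only [sumP, sumSideP, Set.mem_ofPred_eq]; grind
  · intro x x' y; simp only [sumP, sumSideP, Set.mem_ofPred_eq]; grind

theorem PS_prod {A B : PData} (hA : PS A) (hB : PS B) : PS (prodP A B) := by
  obtain ⟨a1, a2, a3, a4, a5, a6, a7, a8, a9⟩ := hA
  obtain ⟨b1, b2, b3, b4, b5, b6, b7, b8, b9⟩ := hB
  constructor
  all_goals intros
  all_goals simp only [prodP, Set.mem_ofPred_eq] at *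
  all_goals grind

theorem PS_func {A B : PData} (hA : PS A) (hB : PS B) : PS (funcP A B) := by
  obtain ⟨a1, a2, a3, a4, a5, a6, a7, a8, a9⟩ := hA
  obtain ⟨b1, b2, b3, b4, b5, b6, b7, b8, b9⟩ := hB
  constructor
  · rintro x ⟨X, a, rfl, h1, h2⟩
    exact ⟨X, a, X, a, rfl, rfl, h1, h2, h1, h2, fun v hv => ⟨v, hv, a1 _ (h1.1 v hv)⟩, b1 _ h2⟩
  · rintro x y z ⟨X, a, Y, b, rfl, rfl, h1, h2, h3, h4, h5, h6⟩
      ⟨Y', b', Z, c, h, rfl, g1, g2, g3, g4, g5, g6⟩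
    simp only [Pm.fn.injEq] at h
    obtain ⟨rfl, rfl⟩ := h
    refine ⟨X, a, Z, c, rfl, rfl, h1, h2, g3, g4, ?_, b2 _ _ _ h6 g6⟩
    intro v hv
    obtain ⟨u, hu, hvu⟩ := g5 v hv
    obtain ⟨w, hw, huw⟩ := h5 u hu
    exact ⟨w, hw, a2 _ _ _ hvu huw⟩
  · rintro x y ⟨X, a, Y, b, rfl, rfl, h1, h2, h3, h4, h5, h6⟩
    exact ⟨X, a, rfl, h1, h2⟩
  · rintro x y ⟨X, a, Y, b, rfl, rfl, h1, h2, h3, h4, h5, h6⟩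
    exact ⟨Y, b, rfl, h3, h4⟩
  · rintro x y ⟨X, a, Y, b, rfl, rfl, h1, h2, h3, h4, h5⟩
    exact ⟨X, a, rfl, h1, h2⟩
  · rintro x y ⟨X, a, Y, b, rfl, rfl, h1, h2, h3, h4, h5⟩
    exact ⟨Y, b, rfl, h3, h4⟩
  · rintro x ⟨X, a, rfl, h1, h2⟩
    exact ⟨X, a, X, a, rfl, rfl, h1, h2, h1, h2, fun _ => b7 _ h2⟩
  · rintro x y ⟨X, a, Y, b, rfl, rfl, h1, h2, h3, h4, h5⟩
    exact ⟨Y, b, X, a, rfl, rfl, h3, h4, h1, h2,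
      fun h => b8 _ _ (h5 fun u hu v hv => a8 _ _ (h v hv u hu))⟩
  · rintro x y z ⟨X, a, Y, b, rfl, rfl, h1, h2, h3, h4, h5, h6⟩
      ⟨Y', b', Z, c, h, rfl, g1, g2, g3, g4, g5⟩
    simp only [Pm.fn.injEq] at h
    obtain ⟨rfl, rfl⟩ := h
    refine ⟨X, a, Z, c, rfl, rfl, h1, h2, g3, g4, fun h => b9 _ _ _ h6 (g5 ?_)⟩
    intro u hu v hv
    obtain ⟨w, hw, huw⟩ := h5 u hu
    exact a9 _ _ _ huw (h w hw v hv)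

theorem PS_simple (s : TyExpr) : PS (interpSimple s) := by
  induction s with
  | void => exact PS_void
  | tvar => exact PS_void
  | mu => exact PS_void
  | sum a b iha ihb => exact PS_sum iha ihb
  | prod a b iha ihb => exact PS_prod iha ihb
  | arrow a b iha ihb => exact PS_func iha ihb

theorem Sub_refl {A : PData} (h : PS A) : Sub A A := by
  obtain ⟨a1, a2, a3, a4, a5, a6, a7, a8, a9⟩ := h
  constructor <;> grind

theorem Sub_void (A : PData) : Sub voidP A := by
  constructor <;> simp [voidP]

theorem Sub_sum {A B A' B' : PData} (hA : Sub A A') (hB : Sub B B') :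
    Sub (sumP A B) (sumP A' B') := by
  obtain ⟨a1, a2, a3⟩ := hA
  obtain ⟨b1, b2, b3⟩ := hB
  constructor
  · intro x; simp only [mem_sumP]; grind
  · intro x y; simp only [mem_sumP]; simp only [sumP, sumSideP, Set.mem_ofPred_eq]; grind
  · intro x y; simp only [mem_sumP]; simp only [sumP, sumSideP, Set.mem_ofPred_eq]; grind

theorem Sub_prod {A B A' B' : PData} (hA : Sub A A') (hB : Sub B B') :
    Sub (prodP A B) (prodP A' B') := by
  obtain ⟨a1, a2, a3⟩ := hA
  obtain ⟨b1, b2, b3⟩ := hB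
  constructor
  all_goals intros
  all_goals simp only [prodP, Set.mem_ofPred_eq] at *
  all_goals grind

theorem Sub_good {A A' : PData} (hA : Sub A A') (X : List Pm) :
    goodList A X ↔ (∀ x ∈ X, x ∈ A.carrier) ∧ goodList A' X := by
  obtain ⟨a1, a2, a3⟩ := hA
  unfold goodList
  grind

theorem Sub_func {A B A' B' : PData} (hA : Sub A A') (hB : Sub B B') :
    Sub (funcP A B) (funcP A' B') := by
  have hg := Sub_good hA
  obtain ⟨a1, a2, a3⟩ := hA
  obtain ⟨b1, b2, b3⟩ := hB
  have key : ∀ X a, Pm.fn X a ∈ (funcP A B).carrier ↔ goodList A X ∧ a ∈ B.carrier := by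
    intro X a; simp [funcP]
  constructor
  · rintro x ⟨X, a, rfl, h1, h2⟩
    exact ⟨X, a, rfl, ((hg X).1 h1).2, b1 _ h2⟩
  · intro x y; constructor
    · rintro ⟨X, a, Y, b, rfl, rfl, h1, h2, h3, h4, h5⟩
      refine ⟨(key _ _).2 ⟨h1, h2⟩, (key _ _).2 ⟨h3, h4⟩, X, a, Y, b, rfl, rfl, ((hg X).1 h1).2,
        b1 _ h2, ((hg Y).1 h3).2, b1 _ h4, fun h => ?_⟩
      refine ((b2 _ _).1 (h5 fun u hu v hv => (a2 _ _).2 ⟨h1.1 u hu, h3.1 v hv, h u hu v hv⟩)).2.2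
    · rintro ⟨h1, h2, X, a, Y, b, rfl, rfl, g1, g2, g3, g4, g5⟩
      rw [key] at h1 h2
      refine ⟨X, a, Y, b, rfl, rfl, h1.1, h1.2, h2.1, h2.2, fun h => (b2 _ _).2
        ⟨h1.2, h2.2, g5 fun u hu v hv => ((a2 _ _).1 (h u hu v hv)).2.2⟩⟩
  · intro x y; constructor
    · rintro ⟨X, a, Y, b, rfl, rfl, h1, h2, h3, h4, h5, h6⟩
      refine ⟨(key _ _).2 ⟨h1, h2⟩, (key _ _).2 ⟨h3, h4⟩, X, a, Y, b, rfl, rfl, ((hg X).1 h1).2,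
        b1 _ h2, ((hg Y).1 h3).2, b1 _ h4, fun v hv => ?_, ((b3 _ _).1 h6).2.2⟩
      obtain ⟨u, hu, huv⟩ := h5 v hv
      exact ⟨u, hu, ((a3 _ _).1 huv).2.2⟩
    · rintro ⟨h1, h2, X, a, Y, b, rfl, rfl, g1, g2, g3, g4, g5, g6⟩
      rw [key] at h1 h2
      refine ⟨X, a, Y, b, rfl, rfl, h1.1, h1.2, h2.1, h2.2, fun v hv => ?_,
        (b3 _ _).2 ⟨h1.2, h2.2, g6⟩⟩
      obtain ⟨u, hu, huv⟩ := g5 v hv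
      exact ⟨u, hu, (a3 _ _).2 ⟨h2.1.1 v hv, h1.1.1 u hu, huv⟩⟩

theorem Sub_pre {s t : TyExpr} (h : Pre s t) : Sub (interpSimple s) (interpSimple t) := by
  induction h with
  | void => exact Sub_void _
  | sum _ _ h1 h2 => exact Sub_sum h1 h2
  | prod _ _ h1 h2 => exact Sub_prod h1 h2
  | arrow _ _ h1 h2 => exact Sub_func h1 h2

/-! ### Unfoldings are directed -/

theorem Unfold_diamond {a b : TyExpr} (h : Unfold a b) : ∀ c, Unfold a c →
    b = c ∨ ∃ d, Unfold b d ∧ Unfold c d := by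
  induction h with
  | mu t a => intro c h; cases h; exact Or.inl rfl
  | sumL b h ih =>
    intro c hc
    cases hc with
    | sumL _ h' =>
      rcases ih _ h' with rfl | ⟨d, h1, h2⟩
      · exact Or.inl rfl
      · exact Or.inr ⟨_, .sumL _ h1, .sumL _ h2⟩
    | sumR _ h' => exact Or.inr ⟨_, .sumR _ h', .sumL _ h⟩
  | sumR b h ih =>
    intro c hc
    cases hc with
    | sumR _ h' =>
      rcases ih _ h' with rfl | ⟨d, h1, h2⟩
      · exact Or.inl rfl
      · exact Or.inr ⟨_, .sumR _ h1, .sumR _ h2⟩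
    | sumL _ h' => exact Or.inr ⟨_, .sumL _ h', .sumR _ h⟩
  | prodL b h ih =>
    intro c hc
    cases hc with
    | prodL _ h' =>
      rcases ih _ h' with rfl | ⟨d, h1, h2⟩
      · exact Or.inl rfl
      · exact Or.inr ⟨_, .prodL _ h1, .prodL _ h2⟩
    | prodR _ h' => exact Or.inr ⟨_, .prodR _ h', .prodL _ h⟩
  | prodR b h ih =>
    intro c hc
    cases hc with
    | prodR _ h' =>
      rcases ih _ h' with rfl | ⟨d, h1, h2⟩
      · exact Or.inl rfl
      · exact Or.inr ⟨_, .prodR _ h1, .prodR _ h2⟩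
    | prodL _ h' => exact Or.inr ⟨_, .prodL _ h', .prodR _ h⟩
  | arrowL b h ih =>
    intro c hc
    cases hc with
    | arrowL _ h' =>
      rcases ih _ h' with rfl | ⟨d, h1, h2⟩
      · exact Or.inl rfl
      · exact Or.inr ⟨_, .arrowL _ h1, .arrowL _ h2⟩
    | arrowR _ h' => exact Or.inr ⟨_, .arrowR _ h', .arrowL _ h⟩
  | arrowR b h ih =>
    intro c hc
    cases hc with
    | arrowR _ h' =>
      rcases ih _ h' with rfl | ⟨d, h1, h2⟩
      · exact Or.inl rfl
      · exact Or.inr ⟨_, .arrowR _ h1, .arrowR _ h2⟩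
    | arrowL _ h' => exact Or.inr ⟨_, .arrowL _ h', .arrowR _ h⟩

theorem Unfolds_confl {a b c : TyExpr} (h1 : Unfolds a b) (h2 : Unfolds a c) :
    ∃ d, Unfolds b d ∧ Unfolds c d := by
  refine Relation.church_rosser ?_ h1 h2
  intro a b c h1 h2
  rcases Unfold_diamond h1 _ h2 with rfl | ⟨d, h3, h4⟩
  · exact ⟨b, .refl, .refl⟩
  · exact ⟨d, .single h3, .single h4⟩

theorem Pre_unfold {t t' : TyExpr} (h : Unfold t t') : ∀ s, Pre s t → Pre s t' := by
  induction h with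
  | mu t a => intro s h; cases h; exact .void _
  | sumL _ _ ih | sumR _ _ ih =>
    intro s h; cases h with
    | void => exact .void _
    | sum h1 h2 => first | exact .sum (ih _ h1) h2 | exact .sum h1 (ih _ h2)
  | prodL _ _ ih | prodR _ _ ih =>
    intro s h; cases h with
    | void => exact .void _
    | prod h1 h2 => first | exact .prod (ih _ h1) h2 | exact .prod h1 (ih _ h2)
  | arrowL _ _ ih | arrowR _ _ ih =>
    intro s h; cases h with
    | void => exact .void _
    | arrow h1 h2 => first | exact .arrow (ih _ h1) h2 | exact .arrow h1 (ih _ h2)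

theorem Pre_unfolds {s t t' : TyExpr} (h : Unfolds t t') (hs : Pre s t) : Pre s t' := by
  induction h with
  | refl => exact hs
  | tail _ h ih => exact Pre_unfold h _ ih

theorem Pre_sup {s₁ t : TyExpr} (h1 : Pre s₁ t) : ∀ s₂, Pre s₂ t →
    ∃ s, Pre s₁ s ∧ Pre s₂ s ∧ Pre s t := by
  have refl : ∀ {s t}, Pre s t → Pre s s := by
    intro s t h
    induction h with
    | void => exact .void _
    | sum _ _ h1 h2 => exact .sum h1 h2
    | prod _ _ h1 h2 => exact .prod h1 h2
    | arrow _ _ h1 h2 => exact .arrow h1 h2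
  induction h1 with
  | void => intro s₂ h; exact ⟨s₂, .void _, refl h, h⟩
  | sum g1 g2 ih1 ih2 =>
    intro s₂ h; cases h with
    | void => exact ⟨_, refl (.sum g1 g2), .void _, .sum g1 g2⟩
    | sum k1 k2 =>
      obtain ⟨a, a1, a2, a3⟩ := ih1 _ k1
      obtain ⟨b, b1, b2, b3⟩ := ih2 _ k2
      exact ⟨_, .sum a1 b1, .sum a2 b2, .sum a3 b3⟩
  | prod g1 g2 ih1 ih2 =>
    intro s₂ h; cases h with
    | void => exact ⟨_, refl (.prod g1 g2), .void _, .prod g1 g2⟩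
    | prod k1 k2 =>
      obtain ⟨a, a1, a2, a3⟩ := ih1 _ k1
      obtain ⟨b, b1, b2, b3⟩ := ih2 _ k2
      exact ⟨_, .prod a1 b1, .prod a2 b2, .prod a3 b3⟩
  | arrow g1 g2 ih1 ih2 =>
    intro s₂ h; cases h with
    | void => exact ⟨_, refl (.arrow g1 g2), .void _, .arrow g1 g2⟩
    | arrow k1 k2 =>
      obtain ⟨a, a1, a2, a3⟩ := ih1 _ k1
      obtain ⟨b, b1, b2, b3⟩ := ih2 _ k2
      exact ⟨_, .arrow a1 b1, .arrow a2 b2, .arrow a3 b3⟩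

theorem unfolding_directed {τ s₁ s₂ : TyExpr} (h1 : s₁ ∈ unfolding τ) (h2 : s₂ ∈ unfolding τ) :
    ∃ s ∈ unfolding τ, Pre s₁ s ∧ Pre s₂ s := by
  obtain ⟨t1, u1, p1⟩ := h1
  obtain ⟨t2, u2, p2⟩ := h2
  obtain ⟨t, k1, k2⟩ := Unfolds_confl u1 u2
  obtain ⟨s, a, b, c⟩ := Pre_sup (Pre_unfolds k1 p1) _ (Pre_unfolds k2 p2)
  exact ⟨s, ⟨t, u1.trans k1, c⟩, a, b⟩

theorem void_mem_unfolding (τ : TyExpr) : TyExpr.void ∈ unfolding τ := ⟨τ, .refl, .void _⟩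

theorem Sub_tyInterp {τ s : TyExpr} (h : s ∈ unfolding τ) : Sub (interpSimple s) (tyInterp τ) := by
  have hs := PS_simple s
  constructor
  · intro x hx; exact ⟨s, h, hx⟩
  · intro x y; constructor
    · intro hc; exact ⟨hs.con_l _ _ hc, hs.con_r _ _ hc, s, h, hc⟩
    · rintro ⟨hx, hy, s', h', hc⟩
      obtain ⟨r, hr, r1, r2⟩ := unfolding_directed h h'
      exact ((Sub_pre r1).con _ _).2 ⟨hx, hy, (((Sub_pre r2).con _ _).1 hc).2.2⟩
  · intro x y; constructor
    · intro hc; exact ⟨hs.le_l _ _ hc, hs.le_r _ _ hc, s, h, hc⟩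
    · rintro ⟨hx, hy, s', h', hc⟩
      obtain ⟨r, hr, r1, r2⟩ := unfolding_directed h h'
      exact ((Sub_pre r1).le _ _).2 ⟨hx, hy, (((Sub_pre r2).le _ _).1 hc).2.2⟩

theorem tyInterp_two {τ : TyExpr} {x y : Pm} (hx : x ∈ (tyInterp τ).carrier)
    (hy : y ∈ (tyInterp τ).carrier) :
    ∃ s ∈ unfolding τ, x ∈ (interpSimple s).carrier ∧ y ∈ (interpSimple s).carrier := by
  obtain ⟨s, h, hx⟩ := hx
  obtain ⟨s', h', hy⟩ := hy
  obtain ⟨r, hr, r1, r2⟩ := unfolding_directed h h'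
  exact ⟨r, hr, (Sub_pre r1).carrier _ hx, (Sub_pre r2).carrier _ hy⟩

theorem PS_tyInterp (τ : TyExpr) : PS (tyInterp τ) := by
  have hl : ∀ x y, (tyInterp τ).le x y → x ∈ (tyInterp τ).carrier ∧ y ∈ (tyInterp τ).carrier := by
    rintro x y ⟨s, h, hc⟩
    exact ⟨⟨s, h, (PS_simple s).le_l _ _ hc⟩, ⟨s, h, (PS_simple s).le_r _ _ hc⟩⟩
  have hcn : ∀ x y, (tyInterp τ).con x y → x ∈ (tyInterp τ).carrier ∧ y ∈ (tyInterp τ).carrier := by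
    rintro x y ⟨s, h, hc⟩
    exact ⟨⟨s, h, (PS_simple s).con_l _ _ hc⟩, ⟨s, h, (PS_simple s).con_r _ _ hc⟩⟩
  have three : ∀ x y z, x ∈ (tyInterp τ).carrier → y ∈ (tyInterp τ).carrier →
      z ∈ (tyInterp τ).carrier → ∃ s ∈ unfolding τ, x ∈ (interpSimple s).carrier ∧
        y ∈ (interpSimple s).carrier ∧ z ∈ (interpSimple s).carrier := by
    intro x y z hx hy hz
    obtain ⟨s, h, hx, hy⟩ := tyInterp_two hx hy
    obtain ⟨s', h', hz⟩ := hz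
    obtain ⟨r, hr, r1, r2⟩ := unfolding_directed h h'
    exact ⟨r, hr, (Sub_pre r1).carrier _ hx, (Sub_pre r1).carrier _ hy, (Sub_pre r2).carrier _ hz⟩
  constructor
  · rintro x ⟨s, h, hc⟩
    exact ⟨s, h, (PS_simple s).le_refl _ hc⟩
  · intro x y z h1 h2
    obtain ⟨s, h, hx, hy, hz⟩ := three x y z (hl _ _ h1).1 (hl _ _ h1).2 (hl _ _ h2).2
    have S := Sub_tyInterp h
    exact ⟨s, h, (PS_simple s).le_trans _ _ _ ((S.le _ _).2 ⟨hx, hy, h1⟩)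
      ((S.le _ _).2 ⟨hy, hz, h2⟩)⟩
  · exact fun x y h => (hl x y h).1
  · exact fun x y h => (hl x y h).2
  · exact fun x y h => (hcn x y h).1
  · exact fun x y h => (hcn x y h).2
  · rintro x ⟨s, h, hc⟩
    exact ⟨s, h, (PS_simple s).con_refl _ hc⟩
  · rintro x y ⟨s, h, hc⟩
    exact ⟨s, h, (PS_simple s).con_symm _ _ hc⟩
  · intro x y z h1 h2
    obtain ⟨s, h, hx, hy, hz⟩ := three x y z (hl _ _ h1).1 (hl _ _ h1).2 (hcn _ _ h2).2
    have S := Sub_tyInterp h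
    exact ⟨s, h, (PS_simple s).con_down _ _ _ ((S.le _ _).2 ⟨hx, hy, h1⟩)
      ((S.con _ _).2 ⟨hy, hz, h2⟩)⟩

theorem PData_ext {A B : PData} (h1 : ∀ x, x ∈ A.carrier ↔ x ∈ B.carrier)
    (h2 : ∀ x y, A.con x y ↔ B.con x y) (h3 : ∀ x y, A.le x y ↔ B.le x y) : A = B := by
  cases A; cases B
  simp only [PData.mk.injEq]
  exact ⟨Set.ext h1, funext fun x => funext fun y => propext (h2 x y),
    funext fun x => funext fun y => propext (h3 x y)⟩

theorem tyInterp_op (op : PData → PData → PData) (a b c : TyExpr)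
    (hsub : ∀ A B A' B', Sub A A' → Sub B B' → Sub (op A B) (op A' B'))
    (hps : ∀ A B, PS A → PS B → PS (op A B))
    (hunf : ∀ s, s ∈ unfolding c → s = .void ∨ ∃ s₁ ∈ unfolding a, ∃ s₂ ∈ unfolding b,
      interpSimple s = op (interpSimple s₁) (interpSimple s₂))
    (hunf' : ∀ s₁ ∈ unfolding a, ∀ s₂ ∈ unfolding b, ∃ s ∈ unfolding c,
      interpSimple s = op (interpSimple s₁) (interpSimple s₂))
    (hcar : ∀ p ∈ (op (tyInterp a) (tyInterp b)).carrier, ∃ s₁ ∈ unfolding a, ∃ s₂ ∈ unfolding b,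
      p ∈ (op (interpSimple s₁) (interpSimple s₂)).carrier) :
    tyInterp c = op (tyInterp a) (tyInterp b) := by
  have hP := hps _ _ (PS_tyInterp a) (PS_tyInterp b)
  have S : ∀ s ∈ unfolding c, Sub (interpSimple s) (op (tyInterp a) (tyInterp b)) := by
    intro s hs
    rcases hunf s hs with rfl | ⟨s₁, h1, s₂, h2, e⟩
    · exact Sub_void _
    · rw [e]; exact hsub _ _ _ _ (Sub_tyInterp h1) (Sub_tyInterp h2)
  have two : ∀ x ∈ (op (tyInterp a) (tyInterp b)).carrier,
      ∀ y ∈ (op (tyInterp a) (tyInterp b)).carrier, ∃ s ∈ unfolding c,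
        x ∈ (interpSimple s).carrier ∧ y ∈ (interpSimple s).carrier := by
    intro x hx y hy
    obtain ⟨s₁, h1, s₂, h2, hx⟩ := hcar x hx
    obtain ⟨r₁, k1, r₂, k2, hy⟩ := hcar y hy
    obtain ⟨q₁, hq1, i1, j1⟩ := unfolding_directed h1 k1
    obtain ⟨q₂, hq2, i2, j2⟩ := unfolding_directed h2 k2
    obtain ⟨s, hs, e⟩ := hunf' _ hq1 _ hq2
    refine ⟨s, hs, ?_, ?_⟩
    · rw [e]; exact (hsub _ _ _ _ (Sub_pre i1) (Sub_pre i2)).carrier _ hx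
    · rw [e]; exact (hsub _ _ _ _ (Sub_pre j1) (Sub_pre j2)).carrier _ hy
  apply PData_ext
  · intro x; constructor
    · rintro ⟨s, hs, hx⟩; exact (S s hs).carrier _ hx
    · intro hx
      obtain ⟨s, hs, h1, h2⟩ := two x hx x hx
      exact ⟨s, hs, h1⟩
  · intro x y; constructor
    · rintro ⟨s, hs, hx⟩; exact (((S s hs).con _ _).1 hx).2.2
    · intro h
      obtain ⟨s, hs, h1, h2⟩ := two x (hP.con_l _ _ h) y (hP.con_r _ _ h)
      exact ⟨s, hs, ((S s hs).con _ _).2 ⟨h1, h2, h⟩⟩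
  · intro x y; constructor
    · rintro ⟨s, hs, hx⟩; exact (((S s hs).le _ _).1 hx).2.2
    · intro h
      obtain ⟨s, hs, h1, h2⟩ := two x (hP.le_l _ _ h) y (hP.le_r _ _ h)
      exact ⟨s, hs, ((S s hs).le _ _).2 ⟨h1, h2, h⟩⟩

theorem Unfolds_sum {a b c : TyExpr} (h : Unfolds (.sum a b) c) :
    ∃ a' b', c = .sum a' b' ∧ Unfolds a a' ∧ Unfolds b b' := by
  induction h with
  | refl => exact ⟨a, b, rfl, .refl, .refl⟩
  | tail _ h ih =>
    obtain ⟨a', b', rfl, h1, h2⟩ := ih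
    cases h with
    | sumL _ h => exact ⟨_, _, rfl, h1.tail h, h2⟩
    | sumR _ h => exact ⟨_, _, rfl, h1, h2.tail h⟩

theorem Unfolds_prod {a b c : TyExpr} (h : Unfolds (.prod a b) c) :
    ∃ a' b', c = .prod a' b' ∧ Unfolds a a' ∧ Unfolds b b' := by
  induction h with
  | refl => exact ⟨a, b, rfl, .refl, .refl⟩
  | tail _ h ih =>
    obtain ⟨a', b', rfl, h1, h2⟩ := ih
    cases h with
    | prodL _ h => exact ⟨_, _, rfl, h1.tail h, h2⟩
    | prodR _ h => exact ⟨_, _, rfl, h1, h2.tail h⟩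

theorem Unfolds_arrow {a b c : TyExpr} (h : Unfolds (.arrow a b) c) :
    ∃ a' b', c = .arrow a' b' ∧ Unfolds a a' ∧ Unfolds b b' := by
  induction h with
  | refl => exact ⟨a, b, rfl, .refl, .refl⟩
  | tail _ h ih =>
    obtain ⟨a', b', rfl, h1, h2⟩ := ih
    cases h with
    | arrowL _ h => exact ⟨_, _, rfl, h1.tail h, h2⟩
    | arrowR _ h => exact ⟨_, _, rfl, h1, h2.tail h⟩

theorem Unfolds_lift (f : TyExpr → TyExpr) (hf : ∀ a b, Unfold a b → Unfold (f a) (f b))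
    {a b : TyExpr} (h : Unfolds a b) : Unfolds (f a) (f b) := by
  induction h with
  | refl => exact .refl
  | tail _ h ih => exact ih.tail (hf _ _ h)

theorem tyInterp_sum (a b : TyExpr) :
    tyInterp (.sum a b) = sumP (tyInterp a) (tyInterp b) := by
  apply tyInterp_op sumP a b _ (fun _ _ _ _ => Sub_sum) (fun _ _ => PS_sum)
  · rintro s ⟨c, h, hp⟩
    obtain ⟨a', b', rfl, h1, h2⟩ := Unfolds_sum h
    cases hp with
    | void => exact Or.inl rfl
    | sum p1 p2 => exact Or.inr ⟨_, ⟨_, h1, p1⟩, _, ⟨_, h2, p2⟩, rfl⟩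
  · rintro s₁ ⟨a', h1, p1⟩ s₂ ⟨b', h2, p2⟩
    exact ⟨.sum s₁ s₂, ⟨.sum a' b', (Unfolds_lift (fun a => .sum a b) (fun _ _ => .sumL b) h1).trans
      (Unfolds_lift (fun b => .sum a' b) (fun _ _ => .sumR a') h2), .sum p1 p2⟩, rfl⟩
  · intro p hp
    rw [mem_sumP] at hp
    rcases hp with h | ⟨x, ⟨s, hs, hx⟩, h⟩ | h | ⟨x, ⟨s, hs, hx⟩, h⟩
    · exact ⟨_, void_mem_unfolding _, _, void_mem_unfolding _, mem_sumP.2 (Or.inl h)⟩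
    · exact ⟨_, hs, _, void_mem_unfolding _, mem_sumP.2 (Or.inr (Or.inl ⟨x, hx, h⟩))⟩
    · exact ⟨_, void_mem_unfolding _, _, void_mem_unfolding _, mem_sumP.2 (Or.inr (Or.inr (Or.inl h)))⟩
    · exact ⟨_, void_mem_unfolding _, _, hs, mem_sumP.2 (Or.inr (Or.inr (Or.inr ⟨x, hx, h⟩)))⟩

theorem tyInterp_prod (a b : TyExpr) :
    tyInterp (.prod a b) = prodP (tyInterp a) (tyInterp b) := by
  apply tyInterp_op prodP a b _ (fun _ _ _ _ => Sub_prod) (fun _ _ => PS_prod)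
  · rintro s ⟨c, h, hp⟩
    obtain ⟨a', b', rfl, h1, h2⟩ := Unfolds_prod h
    cases hp with
    | void => exact Or.inl rfl
    | prod p1 p2 => exact Or.inr ⟨_, ⟨_, h1, p1⟩, _, ⟨_, h2, p2⟩, rfl⟩
  · rintro s₁ ⟨a', h1, p1⟩ s₂ ⟨b', h2, p2⟩
    exact ⟨.prod s₁ s₂, ⟨.prod a' b',
      (Unfolds_lift (fun a => .prod a b) (fun _ _ => .prodL b) h1).trans
      (Unfolds_lift (fun b => .prod a' b) (fun _ _ => .prodR a') h2), .prod p1 p2⟩, rfl⟩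
  · rintro p (⟨x, ⟨s, hs, hx⟩, h⟩ | ⟨x, ⟨s, hs, hx⟩, h⟩)
    · exact ⟨_, hs, _, void_mem_unfolding _, Or.inl ⟨x, hx, h⟩⟩
    · exact ⟨_, void_mem_unfolding _, _, hs, Or.inr ⟨x, hx, h⟩⟩

theorem list_in_simple {a : TyExpr} (X : List Pm) (h : ∀ x ∈ X, x ∈ (tyInterp a).carrier) :
    ∃ s ∈ unfolding a, ∀ x ∈ X, x ∈ (interpSimple s).carrier := by
  induction X with
  | nil => exact ⟨_, void_mem_unfolding a, by simp⟩
  | cons y X ih =>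
    obtain ⟨s, hs, h1⟩ := ih fun x hx => h x (List.mem_cons_of_mem _ hx)
    obtain ⟨s', hs', h2⟩ := h y List.mem_cons_self
    obtain ⟨r, hr, r1, r2⟩ := unfolding_directed hs hs'
    refine ⟨r, hr, fun x hx => ?_⟩
    rcases List.mem_cons.1 hx with rfl | hx
    · exact (Sub_pre r2).carrier _ h2
    · exact (Sub_pre r1).carrier _ (h1 x hx)

theorem tyInterp_arrow (a b : TyExpr) :
    tyInterp (.arrow a b) = funcP (tyInterp a) (tyInterp b) := by
  apply tyInterp_op funcP a b _ (fun _ _ _ _ => Sub_func) (fun _ _ => PS_func)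
  · rintro s ⟨c, h, hp⟩
    obtain ⟨a', b', rfl, h1, h2⟩ := Unfolds_arrow h
    cases hp with
    | void => exact Or.inl rfl
    | arrow p1 p2 => exact Or.inr ⟨_, ⟨_, h1, p1⟩, _, ⟨_, h2, p2⟩, rfl⟩
  · rintro s₁ ⟨a', h1, p1⟩ s₂ ⟨b', h2, p2⟩
    exact ⟨.arrow s₁ s₂, ⟨.arrow a' b',
      (Unfolds_lift (fun a => .arrow a b) (fun _ _ => .arrowL b) h1).trans
      (Unfolds_lift (fun b => .arrow a' b) (fun _ _ => .arrowR a') h2), .arrow p1 p2⟩, rfl⟩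
  · rintro p ⟨X, x, rfl, hX, ⟨s, hs, hx⟩⟩
    obtain ⟨r, hr, h⟩ := list_in_simple X hX.1
    exact ⟨r, hr, s, hs, X, x, rfl, (Sub_good (Sub_tyInterp hr) X).2 ⟨h, hX⟩, hx⟩

theorem tyInterp_void : tyInterp .void = voidP := by
  have h : ∀ s ∈ unfolding .void, s = .void := by
    rintro s ⟨t, h, hp⟩
    have : t = .void := by
      clear hp
      induction h with
      | refl => rfl
      | tail _ h ih => subst ih; cases h
    subst this; cases hp; rfl
  apply PData_ext
  · intro x; constructor
    · rintro ⟨s, hs, hx⟩; rw [h s hs] at hx; exact hx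
    · intro h; exact h.elim
  · intro x y; constructor
    · rintro ⟨s, hs, hx⟩; rw [h s hs] at hx; exact hx
    · intro h; exact h.elim
  · intro x y; constructor
    · rintro ⟨s, hs, hx⟩; rw [h s hs] at hx; exact hx
    · intro h; exact h.elim

theorem tyInterp_mu (t : ℕ) (a : TyExpr) :
    tyInterp (.mu t a) = tyInterp (TyExpr.substTy a t (.mu t a)) := by
  have : unfolding (.mu t a) = unfolding (TyExpr.substTy a t (.mu t a)) := by
    ext s; constructor
    · rintro ⟨c, h, hp⟩
      rcases Relation.ReflTransGen.cases_head h with rfl | ⟨d, h1, h2⟩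
      · cases hp; exact void_mem_unfolding _
      · cases h1; exact ⟨c, h2, hp⟩
    · rintro ⟨c, h, hp⟩
      exact ⟨c, Relation.ReflTransGen.head (.mu t a) h, hp⟩
  simp only [tyInterp, this]

/-! ### Continuity -/

/-- A predicate on sets of primes is Scott open. -/
def Op (P : Set Pm → Prop) : Prop :=
  (∀ d e : Set Pm, d ⊆ e → P d → P e) ∧
  ∀ d, P d → ∃ F : List Pm, (∀ x ∈ F, x ∈ d) ∧ P {x | x ∈ F}

theorem Op_const (p : Prop) : Op fun _ => p :=
  ⟨fun _ _ _ h => h, fun _ h => ⟨[], by simp, h⟩⟩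

theorem Op_mem (a : Pm) : Op fun d => a ∈ d :=
  ⟨fun _ _ h h' => h h', fun _ h => ⟨[a], by simpa using h, by simp⟩⟩

theorem Op_and {P Q : Set Pm → Prop} (hP : Op P) (hQ : Op Q) : Op fun d => P d ∧ Q d := by
  refine ⟨fun d e h h' => ⟨hP.1 d e h h'.1, hQ.1 d e h h'.2⟩, fun d h => ?_⟩
  obtain ⟨F, h1, h2⟩ := hP.2 d h.1
  obtain ⟨G, h3, h4⟩ := hQ.2 d h.2
  refine ⟨F ++ G, ?_, hP.1 _ _ ?_ h2, hQ.1 _ _ ?_ h4⟩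
  · intro x hx
    rcases List.mem_append.1 hx with h | h
    · exact h1 x h
    · exact h3 x h
  · intro x hx; exact List.mem_append.2 (Or.inl hx)
  · intro x hx; exact List.mem_append.2 (Or.inr hx)

theorem Op_exists {ι : Sort*} {P : ι → Set Pm → Prop} (hP : ∀ i, Op (P i)) :
    Op fun d => ∃ i, P i d := by
  refine ⟨fun d e h ⟨i, h'⟩ => ⟨i, (hP i).1 d e h h'⟩, fun d ⟨i, h⟩ => ?_⟩
  obtain ⟨F, h1, h2⟩ := (hP i).2 d h
  exact ⟨F, h1, i, h2⟩

theorem Op_or {P Q : Set Pm → Prop} (hP : Op P) (hQ : Op Q) : Op fun d => P d ∨ Q d := by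
  refine ⟨fun d e h h' => h'.imp (hP.1 d e h) (hQ.1 d e h), fun d h => ?_⟩
  rcases h with h | h
  · obtain ⟨F, h1, h2⟩ := hP.2 d h
    exact ⟨F, h1, Or.inl h2⟩
  · obtain ⟨F, h1, h2⟩ := hQ.2 d h
    exact ⟨F, h1, Or.inr h2⟩

theorem Op_list {f : Set Pm → Set Pm} (hf : ∀ a, Op fun d => a ∈ f d) (X : List Pm) :
    Op fun d => ∀ x ∈ X, x ∈ f d := by
  induction X with
  | nil => simpa using Op_const True
  | cons y X ih => simpa using Op_and (hf y) ih

/-- Continuous set functions. -/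
def Cont (f : Set Pm → Set Pm) : Prop := ∀ a, Op fun d => a ∈ f d

theorem Cont.mono {f : Set Pm → Set Pm} (h : Cont f) {d e : Set Pm} (hde : d ⊆ e) : f d ⊆ f e :=
  fun a ha => (h a).1 d e hde ha

theorem Cont_const (s : Set Pm) : Cont fun _ => s := fun _ => Op_const _

theorem Cont_id : Cont fun d => d := fun a => Op_mem a

theorem Cont_aps {f g : Set Pm → Set Pm} (hf : Cont f) (hg : Cont g) :
    Cont fun d => aps (f d) (g d) := by
  intro b
  exact Op_exists fun X => Op_and (Op_list hg X) (hf _)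

theorem Cont_PrOf {A : PData} {f : Set Pm → Set Pm → Set Pm} (hf : ∀ e, Cont fun d => f d e) :
    Cont fun d => PrOf A (f d) := by
  intro b
  exact Op_exists fun X => Op_exists fun a => Op_and (Op_const _) (Op_and (Op_const _) (hf _ a))

theorem Cont_sem (M : Tm) : ∀ ε : Set Pm → Env, (∀ n, Cont fun d => ε d n) →
    Cont fun d => sem M (ε d) := by
  induction M with
  | var n => intro ε h; exact h n
  | const c => intro ε h; exact Cont_const _
  | app M N ihM ihN => intro ε h; exact Cont_aps (ihM ε h) (ihN ε h)
  | lam σ M ih =>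
    intro ε h
    refine Cont_PrOf fun e => ih (fun d => envCons e (ε d)) ?_
    intro n
    cases n with
    | zero => exact Cont_const _
    | succ n => exact h n

theorem Cont_cons {ε : Env} : ∀ n, Cont fun d => envCons d ε n := by
  intro n
  cases n with
  | zero => exact Cont_id
  | succ n => exact Cont_const _

theorem Cont_inj0 : Cont inj0 := by
  intro b
  exact Op_or (Op_const _) (Op_exists fun a => Op_and (Op_mem a) (Op_const _))

theorem Cont_inj1 : Cont inj1 := by
  intro b
  exact Op_or (Op_const _) (Op_exists fun a => Op_and (Op_mem a) (Op_const _))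

theorem Cont_fstS : Cont fstS := fun _ => Op_mem _
theorem Cont_sndS : Cont sndS := fun _ => Op_mem _
theorem Cont_prj0 : Cont prj0 := fun _ => Op_mem _
theorem Cont_prj1 : Cont prj1 := fun _ => Op_mem _

theorem Cont_pairS {f g : Set Pm → Set Pm} (hf : Cont f) (hg : Cont g) :
    Cont fun d => pairS (f d) (g d) := by
  intro b
  exact Op_or (Op_exists fun a => Op_and (hf a) (Op_const _))
    (Op_exists fun a => Op_and (hg a) (Op_const _))

theorem Cont_caseS {f g h : Set Pm → Set Pm} (hf : Cont f) (hg : Cont g) (hh : Cont h) :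
    Cont fun d => caseS (f d) (g d) (h d) := by
  intro b
  exact Op_or (Op_and (hf _) (Cont_aps hg (fun a => hf (.spr false a)) b))
    (Op_and (hf _) (Cont_aps hh (fun a => hf (.spr true a)) b))

theorem mem_pcaseS {a b c : Set Pm} {p : Pm} : p ∈ pcaseS a b c ↔
    (p ∈ b ∧ p ∈ c) ∨ (Pm.stag false ∈ a ∧ p ∈ b) ∨ (Pm.stag true ∈ a ∧ p ∈ c) := by
  simp only [pcaseS, Set.mem_ofPred_eq, Set.mem_inter_iff]
  tauto

theorem Cont_pcaseS {f g h : Set Pm → Set Pm} (hf : Cont f) (hg : Cont g) (hh : Cont h) :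
    Cont fun d => pcaseS (f d) (g d) (h d) := by
  intro b
  simp only [mem_pcaseS]
  exact Op_or (Op_and (hg b) (hh b)) (Op_or (Op_and (hf _) (hg b)) (Op_and (hf _) (hh b)))

/-! ### Elements -/

theorem exists_goodList {A : PData} (hA : PS A) {d : Set Pm} (hd : A.IsElem d) (F : List Pm)
    (hF : ∀ x ∈ F, x ∈ d) :
    ∃ X, goodList A X ∧ (∀ x ∈ X, x ∈ d) ∧ ∀ x ∈ F, ∃ y ∈ X, A.le x y := by
  classical
  induction F with
  | nil => exact ⟨[], by simp [goodList], by simp, by simp⟩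
  | cons f F ih =>
    obtain ⟨X, h1, h2, h3⟩ := ih fun x hx => hF x (List.mem_cons_of_mem _ hx)
    have hf : f ∈ d := hF f List.mem_cons_self
    by_cases hfX : ∃ x ∈ X, A.le f x
    · refine ⟨X, h1, h2, fun x hx => ?_⟩
      rcases List.mem_cons.1 hx with rfl | hx
      · exact hfX
      · exact h3 x hx
    · have hY : ∀ x ∈ f :: X.filter (fun x => ¬ A.le x f), x ∈ d := by
        intro x hx
        rcases List.mem_cons.1 hx with rfl | hx
        · exact hf
        · exact h2 x (List.mem_filter.1 hx).1
      refine ⟨f :: X.filter (fun x => ¬ A.le x f), ⟨fun x hx => hd.1 (hY x hx), ?_⟩, hY, ?_⟩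
      · intro x hx y hy
        refine ⟨hd.2.2 x (hY x hx) y (hY y hy), fun hle => ?_⟩
        simp only [List.mem_cons, List.mem_filter, decide_eq_true_eq] at hx hy
        rcases hx with rfl | hx <;> rcases hy with rfl | hy
        · rfl
        · exact absurd ⟨y, hy.1, hle⟩ hfX
        · exact absurd hle hx.2
        · exact (h1.2 x hx.1 y hy.1).2 hle
      · intro x hx
        rcases List.mem_cons.1 hx with rfl | hx
        · exact ⟨x, List.mem_cons_self, hA.le_refl _ (hd.1 hf)⟩
        · obtain ⟨y, hy, hxy⟩ := h3 x hx
          by_cases hyf : A.le y f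
          · exact ⟨f, List.mem_cons_self, hA.le_trans _ _ _ hxy hyf⟩
          · refine ⟨y, List.mem_cons_of_mem _ (List.mem_filter.2 ⟨hy, by simpa using hyf⟩), hxy⟩

theorem downList_sub {A : PData} {d : Set Pm} (hd : A.IsElem d) {X : List Pm}
    (h : ∀ x ∈ X, x ∈ d) : downListP A X ⊆ d := by
  rintro a ⟨x, hx, hle⟩
  exact hd.2.1 a x hle (h x hx)

theorem aps_PrOf {A : PData} (hA : PS A) {f : Set Pm → Set Pm} (hf : Cont f) {d : Set Pm}
    (hd : A.IsElem d) : aps (PrOf A f) d = f d := by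
  ext b; constructor
  · rintro ⟨X, hX, Y, a, h, hY, hb⟩
    simp only [Pm.fn.injEq] at h
    obtain ⟨rfl, rfl⟩ := h
    exact hf.mono (downList_sub hd hX) hb
  · intro hb
    obtain ⟨F, hF, hbF⟩ := (hf b).2 d hb
    obtain ⟨X, h1, h2, h3⟩ := exists_goodList hA hd F hF
    exact ⟨X, h2, X, b, rfl, h1, hf.mono (fun x hx => h3 x hx) hbF⟩

theorem elem_down {A : PData} (hA : PS A) {X : List Pm}
    (h : ∀ x ∈ X, ∀ y ∈ X, A.con x y) : A.IsElem (downListP A X) := by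
  refine ⟨?_, ?_, ?_⟩
  · rintro a ⟨x, _, h⟩; exact hA.le_l _ _ h
  · rintro a b hab ⟨x, hx, h⟩; exact ⟨x, hx, hA.le_trans _ _ _ hab h⟩
  · rintro a ⟨x, hx, hax⟩ b ⟨y, hy, hby⟩
    exact hA.con_down _ _ _ hax (hA.con_symm _ _ (hA.con_down _ _ _ hby
      (hA.con_symm _ _ (h x hx y hy))))

theorem elem_PrOf {A B : PData} (hA : PS A) {f : Set Pm → Set Pm}
    (hf : ∀ d e, d ⊆ e → f d ⊆ f e)
    (h : ∀ d, A.IsElem d → B.IsElem (f d)) : (funcP A B).IsElem (PrOf A f) := by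
  have hd : ∀ X, goodList A X → A.IsElem (downListP A X) := fun X hX =>
    elem_down hA fun x hx y hy => (hX.2 x hx y hy).1
  refine ⟨?_, ?_, ?_⟩
  · rintro p ⟨X, a, rfl, hX, ha⟩
    exact ⟨X, a, rfl, hX, (h _ (hd X hX)).1 ha⟩
  · rintro p q ⟨X, a, Y, b, rfl, rfl, h1, h2, h3, h4, h5, h6⟩ ⟨Y', b', e, hY, hb⟩
    simp only [Pm.fn.injEq] at e
    obtain ⟨rfl, rfl⟩ := e
    refine ⟨X, a, rfl, h1, (h _ (hd X h1)).2.1 _ _ h6 (hf _ _ ?_ hb)⟩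
    rintro c ⟨y, hy, hcy⟩
    obtain ⟨x, hx, hyx⟩ := h5 y hy
    exact ⟨x, hx, hA.le_trans _ _ _ hcy hyx⟩
  · rintro p ⟨X, a, rfl, hX, ha⟩ q ⟨Y, b, rfl, hY, hb⟩
    refine ⟨X, a, Y, b, rfl, rfl, hX, (h _ (hd X hX)).1 ha, hY, (h _ (hd Y hY)).1 hb, fun hc => ?_⟩
    have hXY : A.IsElem (downListP A (X ++ Y)) := by
      apply elem_down hA
      intro x hx y hy
      rcases List.mem_append.1 hx with hx | hx <;> rcases List.mem_append.1 hy with hy | hy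
      · exact (hX.2 x hx y hy).1
      · exact hc x hx y hy
      · exact hA.con_symm _ _ (hc y hy x hx)
      · exact (hY.2 x hx y hy).1
    refine (h _ hXY).2.2 a (hf _ _ ?_ ha) b (hf _ _ ?_ hb)
    · rintro c ⟨x, hx, hcx⟩; exact ⟨x, List.mem_append.2 (Or.inl hx), hcx⟩
    · rintro c ⟨x, hx, hcx⟩; exact ⟨x, List.mem_append.2 (Or.inr hx), hcx⟩

theorem elem_aps {A B : PData} (hA : PS A) (hB : PS B) {r d : Set Pm} (hr : (funcP A B).IsElem r)
    (hd : A.IsElem d) : B.IsElem (aps r d) := by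
  have key : ∀ X a, Pm.fn X a ∈ r → goodList A X ∧ a ∈ B.carrier := by
    intro X a h
    obtain ⟨X', a', e, h1, h2⟩ := hr.1 h
    simp only [Pm.fn.injEq] at e
    obtain ⟨rfl, rfl⟩ := e
    exact ⟨h1, h2⟩
  refine ⟨?_, ?_, ?_⟩
  · rintro b ⟨X, _, h⟩; exact (key _ _ h).2
  · rintro a b hab ⟨X, hX, h⟩
    refine ⟨X, hX, hr.2.1 _ _ ?_ h⟩
    exact ⟨X, a, X, b, rfl, rfl, (key _ _ h).1, hB.le_l _ _ hab, (key _ _ h).1, (key _ _ h).2,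
      fun v hv => ⟨v, hv, hA.le_refl _ ((key _ _ h).1.1 v hv)⟩, hab⟩
  · rintro a ⟨X, hX, h⟩ b ⟨Y, hY, h'⟩
    obtain ⟨X', a', Y', b', e1, e2, -, -, -, -, hc⟩ := hr.2.2 _ h _ h'
    simp only [Pm.fn.injEq] at e1 e2
    obtain ⟨rfl, rfl⟩ := e1
    obtain ⟨rfl, rfl⟩ := e2
    exact hc fun u hu v hv => hd.2.2 u (hX u hu) v (hY v hv)

theorem mem_aps_down {A B : PData} (hA : PS A) (hB : PS B) {r : Set Pm}
    (hr : (funcP A B).IsElem r) {X : List Pm} (hX : goodList A X) (b : Pm) :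
    b ∈ aps r (downListP A X) ↔ Pm.fn X b ∈ r := by
  constructor
  · rintro ⟨Y, hY, h⟩
    obtain ⟨Y', b', e, h1, h2⟩ := hr.1 h
    simp only [Pm.fn.injEq] at e
    obtain ⟨rfl, rfl⟩ := e
    exact hr.2.1 _ _ ⟨X, b, Y, b, rfl, rfl, hX, h2, h1, h2, hY, hB.le_refl _ h2⟩ h
  · intro h
    exact ⟨X, fun x hx => ⟨x, hx, hA.le_refl _ (hX.1 x hx)⟩, h⟩

theorem elem_ext {A B : PData} (hA : PS A) (hB : PS B) {r s : Set Pm}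
    (hr : (funcP A B).IsElem r) (hs : (funcP A B).IsElem s)
    (h : ∀ d, A.IsElem d → aps r d = aps s d) : r = s := by
  have key : ∀ X, goodList A X → ∀ b, Pm.fn X b ∈ r ↔ Pm.fn X b ∈ s := by
    intro X hX b
    rw [← mem_aps_down hA hB hr hX, ← mem_aps_down hA hB hs hX, h]
    exact elem_down hA fun x hx y hy => (hX.2 x hx y hy).1
  ext p; constructor
  · intro hp
    obtain ⟨X, b, rfl, hX, _⟩ := hr.1 hp
    exact (key X hX b).1 hp
  · intro hp
    obtain ⟨X, b, rfl, hX, _⟩ := hs.1 hp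
    exact (key X hX b).2 hp

/-- `d` is an element of the domain of the type `τ`. -/
def El (τ : TyExpr) (d : Set Pm) : Prop := (tyInterp τ).IsElem d

theorem El_congr {σ τ : TyExpr} (h : tyInterp σ = tyInterp τ) {d : Set Pm} (hd : El σ d) :
    El τ d := by
  unfold El; rw [← h]; exact hd

theorem El_empty (τ : TyExpr) : El τ ∅ := by
  refine ⟨by simp, by simp, by simp⟩

theorem El_void {d : Set Pm} (h : El .void d) : d = ∅ := by
  unfold El at h; rw [tyInterp_void] at h
  exact Set.subset_eq_empty h.1 rfl

theorem El_aps {σ τ : TyExpr} {r d : Set Pm} (hr : El (.arrow σ τ) r) (hd : El σ d) :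
    El τ (aps r d) := by
  unfold El at hr; rw [tyInterp_arrow] at hr
  exact elem_aps (PS_tyInterp _) (PS_tyInterp _) hr hd

theorem El_PrOf {σ τ : TyExpr} {f : Set Pm → Set Pm} (hf : Cont f)
    (h : ∀ d, El σ d → El τ (f d)) : El (.arrow σ τ) (PrOf (tyInterp σ) f) := by
  unfold El; rw [tyInterp_arrow]
  exact elem_PrOf (PS_tyInterp _) (fun _ _ => hf.mono) h

theorem El_lam {σ τ : TyExpr} {M : Tm} {ε : Env} (h : ∀ d, El σ d → El τ (sem M (envCons d ε))) :
    El (.arrow σ τ) (sem (.lam σ M) ε) :=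
  El_PrOf (Cont_sem M _ Cont_cons) h

theorem aps_lam {σ : TyExpr} {M : Tm} {ε : Env} {d : Set Pm} (h : El σ d) :
    aps (sem (.lam σ M) ε) d = sem M (envCons d ε) :=
  aps_PrOf (PS_tyInterp _) (Cont_sem M _ Cont_cons) h

theorem El_ext {σ τ : TyExpr} {r s : Set Pm} (hr : El (.arrow σ τ) r) (hs : El (.arrow σ τ) s)
    (h : ∀ d, El σ d → aps r d = aps s d) : r = s := by
  unfold El at hr hs; rw [tyInterp_arrow] at hr hs
  exact elem_ext (PS_tyInterp _) (PS_tyInterp _) hr hs h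

/-! ### Elements of sums and products -/

theorem El_sum {σ τ : TyExpr} {d : Set Pm} (h : El (.sum σ τ) d) :
    (sumP (tyInterp σ) (tyInterp τ)).IsElem d := by
  unfold El at h; rwa [tyInterp_sum] at h

theorem El_sum_spr0 {σ τ : TyExpr} {d : Set Pm} (h : El (.sum σ τ) d) {a : Pm}
    (ha : Pm.spr false a ∈ d) : Pm.stag false ∈ d := by
  have h := El_sum h
  refine h.2.1 _ _ (Or.inl ⟨rfl, ?_⟩) ha
  have := h.1 ha
  rw [mem_sumP] at this
  simp only [sumSideP, Set.mem_ofPred_eq]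
  grind

theorem El_sum_spr1 {σ τ : TyExpr} {d : Set Pm} (h : El (.sum σ τ) d) {a : Pm}
    (ha : Pm.spr true a ∈ d) : Pm.stag true ∈ d := by
  have h := El_sum h
  refine h.2.1 _ _ (Or.inr (Or.inl ⟨rfl, ?_⟩)) ha
  have := h.1 ha
  rw [mem_sumP] at this
  simp only [sumSideP, Set.mem_ofPred_eq]
  grind

theorem El_sum_not {σ τ : TyExpr} {d : Set Pm} (h : El (.sum σ τ) d)
    (h0 : Pm.stag false ∈ d) (h1 : Pm.stag true ∈ d) : False := by
  have := (El_sum h).2.2 _ h0 _ h1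
  simp [sumP, sumSideP] at this

theorem El_prj0 {σ τ : TyExpr} {d : Set Pm} (h : El (.sum σ τ) d) : El σ (prj0 d) := by
  have h := El_sum h
  refine ⟨?_, ?_, ?_⟩
  · intro a ha
    have := h.1 ha
    rw [mem_sumP] at this; grind
  · intro a b hab hb
    exact h.2.1 _ _ (Or.inr (Or.inr (Or.inl ⟨a, b, rfl, rfl, hab⟩))) hb
  · intro a ha b hb
    have := h.2.2 _ ha _ hb
    simp [sumP, sumSideP] at this
    exact this.2.2

theorem El_prj1 {σ τ : TyExpr} {d : Set Pm} (h : El (.sum σ τ) d) : El τ (prj1 d) := by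
  have h := El_sum h
  refine ⟨?_, ?_, ?_⟩
  · intro a ha
    have := h.1 ha
    rw [mem_sumP] at this; grind
  · intro a b hab hb
    exact h.2.1 _ _ (Or.inr (Or.inr (Or.inr ⟨a, b, rfl, rfl, hab⟩))) hb
  · intro a ha b hb
    have := h.2.2 _ ha _ hb
    simp [sumP, sumSideP] at this
    exact this.2.2

theorem El_inj0 {σ τ : TyExpr} {d : Set Pm} (h : El σ d) : El (.sum σ τ) (inj0 d) := by
  obtain ⟨h1, h2, h3⟩ := h
  unfold El; rw [tyInterp_sum]
  refine ⟨?_, ?_, ?_⟩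
  · intro p; rw [mem_sumP]; simp only [inj0, Set.mem_ofPred_eq]
    rintro (h | ⟨a, ha, h⟩)
    · exact Or.inl h
    · exact Or.inr (Or.inl ⟨a, h1 ha, h⟩)
  · intro p q; simp only [sumP, inj0, sumSideP, Set.mem_ofPred_eq]; grind
  · have h1 : ∀ x ∈ d, x ∈ (tyInterp σ).carrier := h1
    intro p hp q hq; left; simp only [inj0, sumSideP, Set.mem_ofPred_eq] at *; grind

theorem El_inj1 {σ τ : TyExpr} {d : Set Pm} (h : El τ d) : El (.sum σ τ) (inj1 d) := by
  obtain ⟨h1, h2, h3⟩ := h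
  unfold El; rw [tyInterp_sum]
  refine ⟨?_, ?_, ?_⟩
  · intro p; rw [mem_sumP]; simp only [inj1, Set.mem_ofPred_eq]
    rintro (h | ⟨a, ha, h⟩)
    · exact Or.inr (Or.inr (Or.inl h))
    · exact Or.inr (Or.inr (Or.inr ⟨a, h1 ha, h⟩))
  · intro p q; simp only [sumP, inj1, sumSideP, Set.mem_ofPred_eq]; grind
  · have h1 : ∀ x ∈ d, x ∈ (tyInterp τ).carrier := h1
    intro p hp q hq; right; simp only [inj1, sumSideP, Set.mem_ofPred_eq] at *; grind

theorem El_prod {σ τ : TyExpr} {d : Set Pm} (h : El (.prod σ τ) d) :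
    (prodP (tyInterp σ) (tyInterp τ)).IsElem d := by
  unfold El at h; rwa [tyInterp_prod] at h

theorem El_fst {σ τ : TyExpr} {d : Set Pm} (h : El (.prod σ τ) d) : El σ (fstS d) := by
  have h := El_prod h
  refine ⟨?_, ?_, ?_⟩
  · intro a ha
    have := h.1 ha
    simp only [prodP, Set.mem_ofPred_eq] at this; grind
  · intro a b hab hb
    exact h.2.1 _ _ (Or.inl ⟨a, b, rfl, rfl, hab⟩) hb
  · intro a ha b hb
    have := h.2.2 _ ha _ hb
    simp only [prodP] at this; grind

theorem El_snd {σ τ : TyExpr} {d : Set Pm} (h : El (.prod σ τ) d) : El τ (sndS d) := by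
  have h := El_prod h
  refine ⟨?_, ?_, ?_⟩
  · intro a ha
    have := h.1 ha
    simp only [prodP, Set.mem_ofPred_eq] at this; grind
  · intro a b hab hb
    exact h.2.1 _ _ (Or.inr ⟨a, b, rfl, rfl, hab⟩) hb
  · intro a ha b hb
    have := h.2.2 _ ha _ hb
    simp only [prodP] at this; grind

theorem El_pair {σ τ : TyExpr} {d e : Set Pm} (hd : El σ d) (he : El τ e) :
    El (.prod σ τ) (pairS d e) := by
  obtain ⟨h1, h2, h3⟩ := hd
  obtain ⟨g1, g2, g3⟩ := he
  have h1 : ∀ x ∈ d, x ∈ (tyInterp σ).carrier := h1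
  have g1 : ∀ x ∈ e, x ∈ (tyInterp τ).carrier := g1
  unfold El; rw [tyInterp_prod]
  refine ⟨?_, ?_, ?_⟩
  · intro p; simp only [prodP, pairS, Set.mem_ofPred_eq]; grind
  · intro p q; simp only [prodP, pairS, Set.mem_ofPred_eq]; grind
  · intro p hp q hq; simp only [prodP, pairS, Set.mem_ofPred_eq] at *; grind

theorem El_pcaseS {σ τ ρ : TyExpr} {x y z : Set Pm} (hx : El (.sum σ τ) x) (hy : El ρ y)
    (hz : El ρ z) : El ρ (pcaseS x y z) := by
  by_cases h0 : Pm.stag false ∈ x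
  · have h1 : Pm.stag true ∉ x := fun h => El_sum_not hx h0 h
    have : pcaseS x y z = y := by ext p; simp [pcaseS, h0, h1]
    rwa [this]
  · by_cases h1 : Pm.stag true ∈ x
    · have : pcaseS x y z = z := by ext p; simp [pcaseS, h0, h1]
      rwa [this]
    · have : pcaseS x y z = y ∩ z := by ext p; simp [pcaseS, h0, h1]
      rw [this]
      exact ⟨fun p hp => hy.1 hp.1, fun a b hab hb => ⟨hy.2.1 a b hab hb.1, hz.2.1 a b hab hb.2⟩,
        fun a ha b hb => hy.2.2 a ha.1 b hb.1⟩

theorem El_caseS {σ τ ρ : TyExpr} {x y z : Set Pm} (hx : El (.sum σ τ) x) (hy : El (.arrow σ ρ) y)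
    (hz : El (.arrow τ ρ) z) : El ρ (caseS x y z) := by
  by_cases h0 : Pm.stag false ∈ x
  · have h1 : Pm.stag true ∉ x := fun h => El_sum_not hx h0 h
    have : caseS x y z = aps y (prj0 x) := by ext p; simp [caseS, h0, h1]
    rw [this]
    exact El_aps hy (El_prj0 hx)
  · by_cases h1 : Pm.stag true ∈ x
    · have : caseS x y z = aps z (prj1 x) := by ext p; simp [caseS, h0, h1]
      rw [this]
      exact El_aps hz (El_prj1 hx)
    · have : caseS x y z = ∅ := by ext p; simp [caseS, h0, h1]
      rw [this]
      exact El_empty _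

/-! ### Application of the constants -/

theorem aps_pcase {σ τ ρ : TyExpr} {x y z : Set Pm} (hx : El (.sum σ τ) x) (hy : El ρ y)
    (hz : El ρ z) : aps (aps (aps (constSem (.cpcase σ τ ρ)) x) y) z = pcaseS x y z := by
  simp only [constSem]
  rw [aps_PrOf (PS_tyInterp _) _ hx, aps_PrOf (PS_tyInterp _) _ hy, aps_PrOf (PS_tyInterp _) _ hz]
  · exact Cont_pcaseS (Cont_const _) (Cont_const _) Cont_id
  · exact Cont_PrOf fun _ => Cont_pcaseS (Cont_const _) Cont_id (Cont_const _)
  · exact Cont_PrOf fun _ => Cont_PrOf fun _ => Cont_pcaseS Cont_id (Cont_const _) (Cont_const _)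

theorem El_pcase (σ τ ρ : TyExpr) : El (constType (.cpcase σ τ ρ)) (constSem (.cpcase σ τ ρ)) := by
  refine El_PrOf (Cont_PrOf fun _ => Cont_PrOf fun _ =>
    Cont_pcaseS Cont_id (Cont_const _) (Cont_const _)) fun x hx => ?_
  refine El_PrOf (Cont_PrOf fun _ => Cont_pcaseS (Cont_const _) Cont_id (Cont_const _))
    fun y hy => ?_
  exact El_PrOf (Cont_pcaseS (Cont_const _) (Cont_const _) Cont_id) fun z hz => El_pcaseS hx hy hz

theorem aps_case {σ τ ρ : TyExpr} {x y z : Set Pm} (hx : El (.sum σ τ) x) (hy : El (.arrow σ ρ) y)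
    (hz : El (.arrow τ ρ) z) :
    aps (aps (aps (constSem (.ccase σ τ ρ)) x) y) z = caseS x y z := by
  simp only [constSem]
  rw [aps_PrOf (PS_tyInterp _) _ hx, aps_PrOf (PS_tyInterp _) _ hy, aps_PrOf (PS_tyInterp _) _ hz]
  · exact Cont_caseS (Cont_const _) (Cont_const _) Cont_id
  · exact Cont_PrOf fun _ => Cont_caseS (Cont_const _) Cont_id (Cont_const _)
  · exact Cont_PrOf fun _ => Cont_PrOf fun _ => Cont_caseS Cont_id (Cont_const _) (Cont_const _)

theorem aps_zero {σ τ : TyExpr} {x : Set Pm} (hx : El σ x) :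
    aps (constSem (.czero σ τ)) x = inj0 x := aps_PrOf (PS_tyInterp _) Cont_inj0 hx

theorem aps_one {σ τ : TyExpr} {x : Set Pm} (hx : El τ x) :
    aps (constSem (.cone σ τ)) x = inj1 x := aps_PrOf (PS_tyInterp _) Cont_inj1 hx

theorem aps_fst {σ τ : TyExpr} {x : Set Pm} (hx : El (.prod σ τ) x) :
    aps (constSem (.cfst σ τ)) x = fstS x := aps_PrOf (PS_tyInterp _) Cont_fstS hx

theorem aps_snd {σ τ : TyExpr} {x : Set Pm} (hx : El (.prod σ τ) x) :
    aps (constSem (.csnd σ τ)) x = sndS x := aps_PrOf (PS_tyInterp _) Cont_sndS hx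

theorem aps_pair {σ τ : TyExpr} {x y : Set Pm} (hx : El σ x) (hy : El τ y) :
    aps (aps (constSem (.cpair σ τ)) x) y = pairS x y := by
  simp only [constSem]
  rw [aps_PrOf (PS_tyInterp _) _ hx, aps_PrOf (PS_tyInterp _) _ hy]
  · exact Cont_pairS (Cont_const _) Cont_id
  · exact Cont_PrOf fun _ => Cont_pairS Cont_id (Cont_const _)

/-- Semantic ternary application. -/
abbrev aps3 (r x y z : Set Pm) : Set Pm := aps (aps (aps r x) y) z

theorem El_aps3 {σ τ ρ π : TyExpr} {r x y z : Set Pm} (hr : El (.arrow σ (.arrow τ (.arrow ρ π))) r)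
    (hx : El σ x) (hy : El τ y) (hz : El ρ z) : El π (aps3 r x y z) :=
  El_aps (El_aps (El_aps hr hx) hy) hz

/-- The sequential conditional on sets. -/
def ifzS (x y z : Set Pm) : Set Pm :=
  {p | (Pm.stag false ∈ x ∧ p ∈ y) ∨ (Pm.stag true ∈ x ∧ p ∈ z)}

theorem aps_ifz {σ : TyExpr} {x y z : Set Pm} (ε : Env) (hx : El boolTy x) (hy : El σ y)
    (hz : El σ z) : aps3 (sem (ifzTm σ) ε) x y z = ifzS x y z := by
  unfold ifzTm aps3
  rw [aps_lam hx, aps_lam hy, aps_lam hz]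
  change aps (aps (aps (constSem (.ccase .void .void σ)) x)
    (sem (.lam .void (.var 2)) (envCons z (envCons y (envCons x ε)))))
    (sem (.lam .void (.var 1)) (envCons z (envCons y (envCons x ε)))) = _
  rw [aps_case hx (El_lam fun d _ => hy) (El_lam fun d _ => hz)]
  ext p
  simp only [caseS, Set.mem_ofPred_eq, ifzS]
  rw [aps_lam (El_prj0 hx), aps_lam (El_prj1 hx)]
  rfl

theorem El_ifzS {σ : TyExpr} {x y z : Set Pm} (hx : El boolTy x) (hy : El σ y)
    (hz : El σ z) : El σ (ifzS x y z) := by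
  by_cases h0 : Pm.stag false ∈ x
  · have h1 : Pm.stag true ∉ x := fun h => El_sum_not hx h0 h
    have : ifzS x y z = y := by ext p; simp [ifzS, h0, h1]
    rwa [this]
  · by_cases h1 : Pm.stag true ∈ x
    · have : ifzS x y z = z := by ext p; simp [ifzS, h0, h1]
      rwa [this]
    · have : ifzS x y z = ∅ := by ext p; simp [ifzS, h0, h1]
      rw [this]
      exact El_empty _

theorem sem_zeroV (ε : Env) : sem zeroV ε = inj0 ∅ := aps_zero (El_empty _)
theorem sem_oneV (ε : Env) : sem oneV ε = inj1 ∅ := aps_one (El_empty _)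
theorem El_zeroV : El boolTy (inj0 ∅) := El_inj0 (El_empty _)
theorem El_oneV : El boolTy (inj1 ∅) := El_inj1 (El_empty _)

/-- Semantic negation. -/
def notS (x : Set Pm) : Set Pm := ifzS x (inj1 ∅) (inj0 ∅)

theorem El_notS {x : Set Pm} (hx : El boolTy x) : El boolTy (notS x) := El_ifzS hx El_oneV El_zeroV

theorem aps_not {x : Set Pm} (ε : Env) (hx : El boolTy x) : aps (sem notTm ε) x = notS x := by
  unfold notTm
  rw [aps_lam hx]
  change aps3 (sem (ifzTm boolTy) (envCons x ε)) x (sem oneV _) (sem zeroV _) = _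
  rw [sem_oneV, sem_zeroV, aps_ifz _ hx El_oneV El_zeroV]
  rfl

/-- Semantic parallel conjunction. -/
def andS (x y : Set Pm) : Set Pm := pcaseS x y (inj1 ∅)

theorem El_andS {x y : Set Pm} (hx : El boolTy x) (hy : El boolTy y) : El boolTy (andS x y) :=
  El_pcaseS hx hy El_oneV

theorem aps_and {x y : Set Pm} (ε : Env) (hx : El boolTy x) (hy : El boolTy y) :
    aps (aps (sem andTm ε) x) y = andS x y := by
  unfold andTm
  rw [aps_lam hx, aps_lam hy]
  change aps3 (constSem _) x y (sem oneV _) = _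
  rw [sem_oneV]
  exact aps_pcase hx hy El_oneV

/-- Semantic parallel disjunction. -/
def orS (x y : Set Pm) : Set Pm := notS (andS (notS x) (notS y))

theorem El_orS {x y : Set Pm} (hx : El boolTy x) (hy : El boolTy y) : El boolTy (orS x y) :=
  El_notS (El_andS (El_notS hx) (El_notS hy))

theorem aps_or {x y : Set Pm} (ε : Env) (hx : El boolTy x) (hy : El boolTy y) :
    aps (aps (sem orTm ε) x) y = orS x y := by
  unfold orTm
  rw [aps_lam hx, aps_lam hy]
  change aps (sem notTm _) (aps (aps (sem andTm _) (aps (sem notTm _) x)) (aps (sem notTm _) y)) = _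
  rw [aps_not _ hx, aps_not _ hy, aps_and _ (El_notS hx) (El_notS hy),
    aps_not _ (El_andS (El_notS hx) (El_notS hy))]
  rfl

/-- Semantic boolean parallel conditional. -/
def pcS (x y z : Set Pm) : Set Pm :=
  orS (orS (andS x y) (andS (notS x) z)) (andS y z)

theorem El_pcS {x y z : Set Pm} (hx : El boolTy x) (hy : El boolTy y) (hz : El boolTy z) :
    El boolTy (pcS x y z) :=
  El_orS (El_orS (El_andS hx hy) (El_andS (El_notS hx) hz)) (El_andS hy hz)

theorem aps_pc {x y z : Set Pm} (ε : Env) (hx : El boolTy x) (hy : El boolTy y)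
    (hz : El boolTy z) : aps3 (sem pcTm ε) x y z = pcS x y z := by
  unfold pcTm aps3
  rw [aps_lam hx, aps_lam hy, aps_lam hz]
  change aps (aps (sem orTm _) (aps (aps (sem orTm _) (aps (aps (sem andTm _) x) y))
    (aps (aps (sem andTm _) (aps (sem notTm _) x)) z))) (aps (aps (sem andTm _) y) z) = _
  rw [aps_not _ hx, aps_and _ hx hy, aps_and _ (El_notS hx) hz, aps_and _ hy hz,
    aps_or _ (El_andS hx hy) (El_andS (El_notS hx) hz),
    aps_or _ (El_orS (El_andS hx hy) (El_andS (El_notS hx) hz)) (El_andS hy hz)]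
  rfl

theorem notS_f (x : Set Pm) : Pm.stag false ∈ notS x ↔ Pm.stag true ∈ x := by
  simp [notS, ifzS, inj0, inj1]
theorem notS_t (x : Set Pm) : Pm.stag true ∈ notS x ↔ Pm.stag false ∈ x := by
  simp [notS, ifzS, inj0, inj1]
theorem andS_f (x y : Set Pm) : Pm.stag false ∈ andS x y ↔ Pm.stag false ∈ x ∧ Pm.stag false ∈ y := by
  simp [andS, mem_pcaseS, inj1]
theorem andS_t (x y : Set Pm) : Pm.stag true ∈ andS x y ↔
    Pm.stag true ∈ x ∨ Pm.stag true ∈ y := by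
  simp [andS, mem_pcaseS, inj1]; tauto
theorem orS_f (x y : Set Pm) : Pm.stag false ∈ orS x y ↔ Pm.stag false ∈ x ∨ Pm.stag false ∈ y := by
  simp [orS, notS_f, andS_t, notS_t]
theorem orS_t (x y : Set Pm) : Pm.stag true ∈ orS x y ↔
    Pm.stag true ∈ x ∧ Pm.stag true ∈ y := by
  simp [orS, notS_t, andS_f, notS_f]

theorem pcS_f (x y z : Set Pm) : Pm.stag false ∈ pcS x y z ↔ Pm.stag false ∈ pcaseS x y z := by
  simp only [pcS, orS_f, andS_f, notS_f, mem_pcaseS]; tauto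

theorem pcS_t {x y z : Set Pm} (hx : El boolTy x) :
    Pm.stag true ∈ pcS x y z ↔ Pm.stag true ∈ pcaseS x y z := by
  have := El_sum_not hx
  simp only [pcS, orS_t, andS_t, notS_t, mem_pcaseS]; tauto

/-- Semantic `sb`. -/
def sbS (x : Set Pm) : Set Pm := ifzS x (inj0 ∅) (inj1 ∅)

theorem sbS_f (x : Set Pm) : Pm.stag false ∈ sbS x ↔ Pm.stag false ∈ x := by
  simp [sbS, ifzS, inj0, inj1]
theorem sbS_t (x : Set Pm) : Pm.stag true ∈ sbS x ↔ Pm.stag true ∈ x := by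
  simp [sbS, ifzS, inj0, inj1]

theorem aps_sb {σ τ : TyExpr} {x : Set Pm} (ε : Env) (hx : El (.sum σ τ) x) :
    aps (sem (sbTm σ τ) ε) x = sbS x := by
  unfold sbTm
  rw [aps_lam hx]
  change aps (aps (aps (constSem (.ccase σ τ boolTy)) x)
    (sem (.lam σ zeroV) (envCons x ε))) (sem (.lam τ oneV) (envCons x ε)) = _
  rw [aps_case hx (El_lam fun d _ => by rw [sem_zeroV]; exact El_zeroV)
    (El_lam fun d _ => by rw [sem_oneV]; exact El_oneV)]
  ext p
  simp only [caseS, Set.mem_ofPred_eq, ifzS, sbS]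
  rw [aps_lam (El_prj0 hx), aps_lam (El_prj1 hx), sem_zeroV, sem_oneV]

theorem El_sbS {σ τ : TyExpr} {x : Set Pm} (hx : El (.sum σ τ) x) : El boolTy (sbS x) := by
  by_cases h0 : Pm.stag false ∈ x
  · have h1 : Pm.stag true ∉ x := fun h => El_sum_not hx h0 h
    have : sbS x = inj0 ∅ := by ext p; simp [sbS, ifzS, h0, h1]
    rw [this]; exact El_zeroV
  · by_cases h1 : Pm.stag true ∈ x
    · have : sbS x = inj1 ∅ := by ext p; simp [sbS, ifzS, h0, h1]
      rw [this]; exact El_oneV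
    · have : sbS x = ∅ := by ext p; simp [sbS, ifzS, h0, h1]
      rw [this]
      exact El_empty _

theorem aps_empty (d : Set Pm) : aps ∅ d = ∅ := by
  ext p; simp [aps]

theorem aps_out0 {σ τ : TyExpr} {x : Set Pm} (ε : Env) (hx : El (.sum σ τ) x) :
    aps (sem (out0Tm σ τ) ε) x = prj0 x := by
  unfold out0Tm
  rw [aps_lam hx]
  change aps (aps (aps (constSem (.ccase σ τ σ)) x)
    (sem (.lam σ (.var 0)) (envCons x ε))) ∅ = _
  rw [aps_case hx (El_lam fun d hd => hd) (El_empty _)]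
  ext p
  simp only [caseS, Set.mem_ofPred_eq]
  rw [aps_lam (El_prj0 hx), aps_empty]
  constructor
  · rintro (h | h)
    · exact h.2
    · exact h.2.elim
  · intro h; exact Or.inl ⟨El_sum_spr0 hx h, h⟩

theorem aps_out1 {σ τ : TyExpr} {x : Set Pm} (ε : Env) (hx : El (.sum σ τ) x) :
    aps (sem (out1Tm σ τ) ε) x = prj1 x := by
  unfold out1Tm
  rw [aps_lam hx]
  change aps (aps (aps (constSem (.ccase σ τ τ)) x) ∅)
    (sem (.lam τ (.var 0)) (envCons x ε)) = _
  rw [aps_case hx (El_empty _) (El_lam fun d hd => hd)]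
  ext p
  simp only [caseS, Set.mem_ofPred_eq]
  rw [aps_lam (El_prj1 hx), aps_empty]
  constructor
  · rintro (h | h)
    · exact h.2.elim
    · exact h.2
  · intro h; exact Or.inr ⟨El_sum_spr1 hx h, h⟩

/-! ### Type substitution -/

theorem substTy_not_free (σ : TyExpr) (t : ℕ) (ρ : TyExpr) (h : t ∉ σ.freeTV) :
    σ.substTy t ρ = σ := by
  induction σ with
  | tvar s => simp [TyExpr.freeTV] at h; simp [TyExpr.substTy, Ne.symm h]
  | void => rfl
  | sum a b iha ihb | prod a b iha ihb | arrow a b iha ihb =>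
    simp [TyExpr.freeTV] at h; simp [TyExpr.substTy, iha h.1, ihb h.2]
  | mu s a ih =>
    simp only [TyExpr.substTy]
    split_ifs with hs
    · rfl
    · simp [TyExpr.freeTV] at h
      rw [ih (h (Ne.symm hs))]

theorem substAllTy_none (σ : TyExpr) : substAllTy (fun _ => none) σ = σ := by
  induction σ with
  | tvar s => rfl
  | void => rfl
  | sum a b iha ihb | prod a b iha ihb | arrow a b iha ihb => simp [substAllTy, iha, ihb]
  | mu s a ih => simp [substAllTy, ih]

theorem substTy_substAllTy (τ : TyExpr) (t : ℕ) (T : TyExpr) : ∀ (θ : ℕ → Option TyExpr),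
    (∀ s S, θ s = some S → S.Closed) →
    (substAllTy (fun s => if s = t then none else θ s) τ).substTy t T =
      substAllTy (fun s => if s = t then some T else θ s) τ := by
  induction τ with
  | tvar s =>
    intro θ hθ
    by_cases hs : s = t
    · simp [substAllTy, hs, TyExpr.substTy]
    · simp only [substAllTy, hs, if_false]
      cases h : θ s with
      | none => simp [TyExpr.substTy, hs]
      | some S =>
        have := hθ s S h
        simp only [Option.getD_some]
        apply substTy_not_free
        rw [this]; simp
  | void => intro θ hθ; rfl
  | sum a b iha ihb | prod a b iha ihb | arrow a b iha ihb =>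
    intro θ hθ
    simp only [substAllTy, TyExpr.substTy, iha θ hθ, ihb θ hθ]
  | mu s a ih =>
    intro θ hθ
    simp only [substAllTy, TyExpr.substTy]
    split_ifs with hs
    · subst hs
      congr 2
      funext r
      split_ifs <;> rfl
    · congr 1
      have := ih (fun r => if r = s then none else θ r) (by
        intro r S h
        split_ifs at h
        exact hθ r S h)
      convert this using 2
      · congr 1
        funext r
        split_ifs <;> rfl
      · funext r
        split_ifs with h1 h2
        · subst h1; exact absurd h2 hs
        · rfl
        · rfl
        · rfl

theorem freeTV_substAllTy (τ : TyExpr) : ∀ (θ : ℕ → Option TyExpr),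
    (∀ s S, θ s = some S → S.Closed) → ∀ r ∈ (substAllTy θ τ).freeTV,
      r ∈ τ.freeTV ∧ θ r = none := by
  induction τ with
  | tvar s =>
    intro θ hθ r hr
    simp only [substAllTy] at hr
    cases h : θ s with
    | none => rw [h] at hr; simp [TyExpr.freeTV] at hr ⊢; subst hr; exact ⟨rfl, h⟩
    | some S =>
      rw [h] at hr
      have := hθ s S h
      simp only [Option.getD_some] at hr
      rw [this] at hr; simp at hr
  | void => intro θ hθ r hr; simp [substAllTy, TyExpr.freeTV] at hr
  | sum a b iha ihb | prod a b iha ihb | arrow a b iha ihb =>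
    intro θ hθ r hr
    simp only [substAllTy, TyExpr.freeTV, Finset.mem_union] at hr ⊢
    rcases hr with hr | hr
    · exact ⟨Or.inl (iha θ hθ r hr).1, (iha θ hθ r hr).2⟩
    · exact ⟨Or.inr (ihb θ hθ r hr).1, (ihb θ hθ r hr).2⟩
  | mu s a ih =>
    intro θ hθ r hr
    simp only [substAllTy, TyExpr.freeTV, Finset.mem_erase] at hr ⊢
    have := ih _ (by
        intro r S h
        split_ifs at h
        exact hθ r S h) r hr.2
    rw [if_neg hr.1] at this
    exact ⟨⟨hr.1, this.1⟩, this.2⟩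

/-! ### Degenerate recursive types -/

/-- The variable reached after stripping leading binders, if it is free. -/
def headV : TyExpr → Option ℕ
  | .tvar t => some t
  | .mu t a => if headV a = some t then none else headV a
  | _ => none

/-- Types of the form `μs₁…μsₖ.t`. -/
def Deg : TyExpr → Prop
  | .tvar _ => True
  | .mu _ a => Deg a
  | _ => False

theorem Deg_substTy (a : TyExpr) (t : ℕ) (X : TyExpr) (ha : Deg a) (hX : Deg X) :
    Deg (a.substTy t X) := by
  induction a with
  | tvar s => simp only [TyExpr.substTy]; split_ifs; exacts [hX, trivial]
  | mu s a ih => simp only [TyExpr.substTy]; split_ifs; exacts [ha, ih ha]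
  | _ => exact ha.elim

theorem Deg_carrier {τ : TyExpr} (h : Deg τ) : (tyInterp τ).carrier = ∅ := by
  ext p
  simp only [Set.mem_empty_iff_false, iff_false]
  rintro ⟨s, ⟨c, hc, hp⟩, hx⟩
  have hd : Deg c := by
    clear hp
    induction hc with
    | refl => exact h
    | tail _ h' ih =>
      cases h' with
      | mu t a => exact Deg_substTy a t _ ih ih
      | _ => exact ih.elim
  cases hp with
  | void => exact hx
  | _ => exact hd.elim

theorem Deg_substAllTy (τ : TyExpr) (u : ℕ) : ∀ θ : ℕ → Option TyExpr, headV τ = some u →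
    θ u = none → Deg (substAllTy θ τ) := by
  induction τ with
  | tvar s =>
    intro θ h hu
    simp only [headV, Option.some.injEq] at h
    subst h
    simp [substAllTy, hu, Deg]
  | mu s a ih =>
    intro θ h hu
    simp only [headV] at h
    split_ifs at h with hs
    refine ih _ h ?_
    split_ifs
    · rfl
    · exact hu
  | _ => intro θ h; simp [headV] at h

theorem headV_free (τ : TyExpr) (u : ℕ) (h : headV τ = some u) : u ∈ τ.freeTV := by
  induction τ with
  | tvar s => simp [headV] at h; simp [TyExpr.freeTV, h]
  | mu s a ih =>
    simp only [headV] at h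
    split_ifs at h with hs
    simp only [TyExpr.freeTV, Finset.mem_erase]
    refine ⟨?_, ih h⟩
    rintro rfl; exact hs h
  | _ => simp [headV] at h

/-! ### The fixed point combinator -/

theorem freshTV_not_free (σ : TyExpr) : freshTV σ ∉ σ.freeTV := by
  intro h
  have := Finset.le_sup (f := id) h
  simp only [freshTV, id] at this
  omega

theorem Y_fix (π : TyExpr) (ε : Env) {G : Set Pm} (hG : El (.arrow π π) G) :
    El π (aps (sem (YTm π) ε) G) ∧
      aps (sem (YTm π) ε) G = aps G (aps (sem (YTm π) ε) G) := by
  have hD : tyInterp (.mu (freshTV π) (.arrow (.tvar (freshTV π)) π)) =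
      tyInterp (.arrow (.mu (freshTV π) (.arrow (.tvar (freshTV π)) π)) π) := by
    rw [tyInterp_mu]
    simp [TyExpr.substTy, substTy_not_free _ _ _ (freshTV_not_free π)]
  unfold YTm
  simp only
  rw [aps_lam hG]
  simp only [sem]
  set D := TyExpr.mu (freshTV π) (.arrow (.tvar (freshTV π)) π) with hDdef
  change El π (aps (sem (.lam D (.app (.var 1) (.app (.var 0) (.var 0)))) (envCons G ε))
    (sem (.lam D (.app (.var 1) (.app (.var 0) (.var 0)))) (envCons G ε))) ∧
    aps (sem (.lam D (.app (.var 1) (.app (.var 0) (.var 0)))) (envCons G ε))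
    (sem (.lam D (.app (.var 1) (.app (.var 0) (.var 0)))) (envCons G ε)) =
    aps G (aps (sem (.lam D (.app (.var 1) (.app (.var 0) (.var 0)))) (envCons G ε))
    (sem (.lam D (.app (.var 1) (.app (.var 0) (.var 0)))) (envCons G ε)))
  have hW : El (.arrow D π) (sem (.lam D (.app (.var 1) (.app (.var 0) (.var 0)))) (envCons G ε)) :=
    El_lam fun d hd => El_aps hG (El_aps (El_congr hD hd) hd)
  have hW' := El_congr hD.symm hW
  refine ⟨El_aps hW hW', ?_⟩
  conv_lhs => rw [aps_lam hW']
  rfl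

/-- The type of the parallel conditional at type `T`. -/
abbrev pty (T : TyExpr) : TyExpr := .arrow boolTy (.arrow T (.arrow T T))

theorem pty_congr {S T : TyExpr} (h : tyInterp S = tyInterp T) :
    tyInterp (pty S) = tyInterp (pty T) := by
  simp only [pty, tyInterp_arrow, h]

/-- The partial maps are compatible with the environment. -/
def GoodMap (θv : ℕ → Option ℕ) (θt : ℕ → Option TyExpr) (ε : Env) : Prop :=
  ∀ t T, θt t = some T → T.Closed ∧ ∃ n, θv t = some n ∧ El (pty T) (ε n)

/-- The map `θt` covers the free variables of `σ`. -/
def Cov (θt : ℕ → Option TyExpr) (σ : TyExpr) : Prop := ∀ t ∈ σ.freeTV, ∃ T, θt t = some T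

theorem GoodMap.closed {θv : ℕ → Option ℕ} {θt : ℕ → Option TyExpr} {ε : Env}
    (h : GoodMap θv θt ε) : ∀ s S, θt s = some S → S.Closed := fun s S hs => (h s S hs).1

theorem GoodMap.shift {θv : ℕ → Option ℕ} {θt : ℕ → Option TyExpr} {ε : Env}
    (h : GoodMap θv θt ε) {k : ℕ} {ε' : Env} (hε : ∀ n, ε' (n + k) = ε n) :
    GoodMap (shiftV θv k) θt ε' := by
  intro t T ht
  obtain ⟨h1, n, h2, h3⟩ := h t T ht
  exact ⟨h1, n + k, by simp [shiftV, h2], by rw [hε]; exact h3⟩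

theorem closed_mu {θt : ℕ → Option TyExpr} (hθ : ∀ s S, θt s = some S → S.Closed) {σ : TyExpr}
    (hc : Cov θt σ) : (substAllTy θt σ).Closed := by
  apply Finset.eq_empty_of_forall_notMem
  intro r hr
  obtain ⟨h1, h2⟩ := freeTV_substAllTy σ θt hθ r hr
  obtain ⟨T, hT⟩ := hc r h1
  rw [hT] at h2; cases h2

theorem GoodMap.update {θv : ℕ → Option ℕ} {θt : ℕ → Option TyExpr} {ε : Env}
    (h : GoodMap θv θt ε) {t : ℕ} {T : TyExpr} (hT : T.Closed) {d : Set Pm} (hd : El (pty T) d) :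
    GoodMap (fun s => if s = t then some 0 else shiftV θv 1 s)
      (fun s => if s = t then some T else θt s) (envCons d ε) := by
  intro s S hs
  by_cases hst : s = t
  · simp only [hst, if_true, Option.some.injEq] at hs ⊢
    subst hs
    exact ⟨hT, 0, rfl, hd⟩
  · simp only [hst, if_false] at hs ⊢
    exact h.shift (k := 1) (ε' := envCons d ε) (fun _ => rfl) s S hs

theorem Cov.update {θt : ℕ → Option TyExpr} {t : ℕ} {τ : TyExpr} (h : Cov θt (.mu t τ))
    (T : TyExpr) : Cov (fun s => if s = t then some T else θt s) τ := by
  intro s hs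
  by_cases hst : s = t
  · exact ⟨T, by simp [hst]⟩
  · obtain ⟨S, hS⟩ := h s (by simp [TyExpr.freeTV, hst, hs])
    exact ⟨S, by simp [hst, hS]⟩

theorem tyInterp_substAll_mu {θt : ℕ → Option TyExpr} (hθ : ∀ s S, θt s = some S → S.Closed)
    (t : ℕ) (τ : TyExpr) :
    tyInterp (substAllTy θt (.mu t τ)) =
      tyInterp (substAllTy (fun s => if s = t then some (substAllTy θt (.mu t τ)) else θt s) τ) := by
  rw [← substTy_substAllTy τ t _ θt hθ]
  conv_lhs => simp only [substAllTy]
  rw [tyInterp_mu]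
  simp only [substAllTy]

theorem sum_body {Tτ Tρ : TyExpr} {P Q : Tm} {ε : Env} {x y z : Set Pm}
    (hP : El (pty Tτ) (sem P (envCons z (envCons y (envCons x ε)))))
    (hQ : El (pty Tρ) (sem Q (envCons z (envCons y (envCons x ε)))))
    (hx : El boolTy x) (hy : El (.sum Tτ Tρ) y) (hz : El (.sum Tτ Tρ) z) :
    sem (app3 (ifzTm (.sum Tτ Tρ))
        (app3 pcTm (.var 2) (.app (sbTm Tτ Tρ) (.var 1)) (.app (sbTm Tτ Tρ) (.var 0)))
        (.app (.const (.czero Tτ Tρ))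
          (app3 P (.var 2)
            (.app (out0Tm Tτ Tρ) (.var 1)) (.app (out0Tm Tτ Tρ) (.var 0))))
        (.app (.const (.cone Tτ Tρ))
          (app3 Q (.var 2)
            (.app (out1Tm Tτ Tρ) (.var 1)) (.app (out1Tm Tτ Tρ) (.var 0)))))
      (envCons z (envCons y (envCons x ε))) =
    ifzS (pcS x (sbS y) (sbS z))
      (inj0 (aps3 (sem P (envCons z (envCons y (envCons x ε)))) x (prj0 y) (prj0 z)))
      (inj1 (aps3 (sem Q (envCons z (envCons y (envCons x ε)))) x (prj1 y) (prj1 z))) ∧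
    El (.sum Tτ Tρ) (ifzS (pcS x (sbS y) (sbS z))
      (inj0 (aps3 (sem P (envCons z (envCons y (envCons x ε)))) x (prj0 y) (prj0 z)))
      (inj1 (aps3 (sem Q (envCons z (envCons y (envCons x ε)))) x (prj1 y) (prj1 z)))) := by
  set η := envCons z (envCons y (envCons x ε)) with hη
  change aps3 (sem (ifzTm _) η) (aps3 (sem pcTm η) x (aps (sem (sbTm Tτ Tρ) η) y)
      (aps (sem (sbTm Tτ Tρ) η) z))
    (aps (constSem (.czero Tτ Tρ)) (aps3 (sem P η) x (aps (sem (out0Tm Tτ Tρ) η) y)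
      (aps (sem (out0Tm Tτ Tρ) η) z)))
    (aps (constSem (.cone Tτ Tρ)) (aps3 (sem Q η) x (aps (sem (out1Tm Tτ Tρ) η) y)
      (aps (sem (out1Tm Tτ Tρ) η) z))) = _ ∧ _
  have h1 := El_aps3 hP hx (El_prj0 hy) (El_prj0 hz)
  have h2 := El_aps3 hQ hx (El_prj1 hy) (El_prj1 hz)
  have h3 := El_pcS hx (El_sbS hy) (El_sbS hz)
  rw [aps_sb _ hy, aps_sb _ hz, aps_out0 _ hy, aps_out0 _ hz, aps_out1 _ hy, aps_out1 _ hz,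
    aps_pc _ hx (El_sbS hy) (El_sbS hz), aps_zero h1, aps_one h2,
    aps_ifz _ h3 (El_inj0 h1) (El_inj1 h2)]
  exact ⟨rfl, El_ifzS h3 (El_inj0 h1) (El_inj1 h2)⟩

theorem prod_body {Tτ Tρ : TyExpr} {P Q : Tm} {ε : Env} {x y z : Set Pm}
    (hP : El (pty Tτ) (sem P (envCons z (envCons y (envCons x ε)))))
    (hQ : El (pty Tρ) (sem Q (envCons z (envCons y (envCons x ε)))))
    (hx : El boolTy x) (hy : El (.prod Tτ Tρ) y) (hz : El (.prod Tτ Tρ) z) :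
    sem (.app (.app (.const (.cpair Tτ Tρ))
          (app3 P (.var 2)
            (.app (.const (.cfst Tτ Tρ)) (.var 1)) (.app (.const (.cfst Tτ Tρ)) (.var 0))))
        (app3 Q (.var 2)
          (.app (.const (.csnd Tτ Tρ)) (.var 1)) (.app (.const (.csnd Tτ Tρ)) (.var 0))))
      (envCons z (envCons y (envCons x ε))) =
    pairS (aps3 (sem P (envCons z (envCons y (envCons x ε)))) x (fstS y) (fstS z))
      (aps3 (sem Q (envCons z (envCons y (envCons x ε)))) x (sndS y) (sndS z)) ∧
    El (.prod Tτ Tρ)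
      (pairS (aps3 (sem P (envCons z (envCons y (envCons x ε)))) x (fstS y) (fstS z))
      (aps3 (sem Q (envCons z (envCons y (envCons x ε)))) x (sndS y) (sndS z))) := by
  set η := envCons z (envCons y (envCons x ε)) with hη
  change aps (aps (constSem (.cpair Tτ Tρ)) (aps3 (sem P η) x (aps (constSem (.cfst Tτ Tρ)) y)
      (aps (constSem (.cfst Tτ Tρ)) z)))
    (aps3 (sem Q η) x (aps (constSem (.csnd Tτ Tρ)) y)
      (aps (constSem (.csnd Tτ Tρ)) z)) = _ ∧ _
  have h1 := El_aps3 hP hx (El_fst hy) (El_fst hz)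
  have h2 := El_aps3 hQ hx (El_snd hy) (El_snd hz)
  rw [aps_fst hy, aps_fst hz, aps_snd hy, aps_snd hz, aps_pair h1 h2]
  exact ⟨rfl, El_pair h1 h2⟩

theorem Pcase_El (σ : TyExpr) : ∀ (θv : ℕ → Option ℕ) (θt : ℕ → Option TyExpr) (ε : Env),
    GoodMap θv θt ε → Cov θt σ → El (pty (substAllTy θt σ)) (sem (PcaseTm θv θt σ) ε) := by
  induction σ with
  | tvar t =>
    intro θv θt ε hg hc
    obtain ⟨T, hT⟩ := hc t (by simp [TyExpr.freeTV])
    obtain ⟨-, n, hn, hE⟩ := hg t T hT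
    simp only [substAllTy, PcaseTm, hT, hn, Option.getD_some, sem]
    exact hE
  | void => intro θv θt ε hg hc; exact El_empty _
  | sum τ ρ ih1 ih2 =>
    intro θv θt ε hg hc
    refine El_lam fun x hx => El_lam fun y hy => El_lam fun z hz => ?_
    have hP := ih1 (shiftV θv 3) θt (envCons z (envCons y (envCons x ε))) (hg.shift fun _ => rfl)
      fun t ht => hc t (by simp [TyExpr.freeTV, ht])
    have hQ := ih2 (shiftV θv 3) θt (envCons z (envCons y (envCons x ε))) (hg.shift fun _ => rfl)
      fun t ht => hc t (by simp [TyExpr.freeTV, ht])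
    obtain ⟨h1, h2⟩ := sum_body hP hQ hx hy hz
    rw [h1]; exact h2
  | prod τ ρ ih1 ih2 =>
    intro θv θt ε hg hc
    refine El_lam fun x hx => El_lam fun y hy => El_lam fun z hz => ?_
    have hP := ih1 (shiftV θv 3) θt (envCons z (envCons y (envCons x ε))) (hg.shift fun _ => rfl)
      fun t ht => hc t (by simp [TyExpr.freeTV, ht])
    have hQ := ih2 (shiftV θv 3) θt (envCons z (envCons y (envCons x ε))) (hg.shift fun _ => rfl)
      fun t ht => hc t (by simp [TyExpr.freeTV, ht])
    obtain ⟨h1, h2⟩ := prod_body hP hQ hx hy hz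
    rw [h1]; exact h2
  | arrow τ ρ ih1 ih2 =>
    intro θv θt ε hg hc
    refine El_lam fun x hx => El_lam fun y hy => El_lam fun z hz => El_lam fun w hw => ?_
    have hP := ih2 (shiftV θv 4) θt (envCons w (envCons z (envCons y (envCons x ε))))
      (hg.shift fun _ => rfl) fun t ht => hc t (by simp [TyExpr.freeTV, ht])
    exact El_aps3 hP hx (El_aps hy hw) (El_aps hz hw)
  | mu t τ ih =>
    intro θv θt ε hg hc
    have hT := closed_mu hg.closed hc
    refine (Y_fix _ ε (El_lam fun d hd => ?_)).1
    exact El_congr (pty_congr (tyInterp_substAll_mu hg.closed t τ).symm)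
      (ih _ _ _ (hg.update hT hd) (hc.update _))

/-! ### Agreement with the parallel conditional on primes of bounded size -/

/-- The depth of a prime. -/
def Pm.sz : Pm → ℕ
  | .stag _ => 0
  | .spr _ a => a.sz + 1
  | .ppr _ a => a.sz + 1
  | .fn _ a => a.sz + 1

/-- `P` agrees with the parallel conditional at `T` on primes of size less than `n`. -/
def Agree (n : ℕ) (T : TyExpr) (P : Set Pm) : Prop :=
  ∀ x y z, El boolTy x → El T y → El T z → ∀ c : Pm, c.sz < n →
    (c ∈ aps3 P x y z ↔ c ∈ pcaseS x y z)

theorem Agree.mono {m n : ℕ} {T : TyExpr} {P : Set Pm} (h : Agree n T P) (hmn : m ≤ n) :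
    Agree m T P := fun x y z hx hy hz c hc => h x y z hx hy hz c (lt_of_lt_of_le hc hmn)

/-- All the variables in the domain of the maps agree up to `n`. -/
def AgreeMap (n : ℕ) (θv : ℕ → Option ℕ) (θt : ℕ → Option TyExpr) (ε : Env) : Prop :=
  ∀ t T k, θt t = some T → θv t = some k → Agree n T (ε k)

theorem AgreeMap.mono {m n : ℕ} {θv : ℕ → Option ℕ} {θt : ℕ → Option TyExpr} {ε : Env}
    (h : AgreeMap n θv θt ε) (hmn : m ≤ n) : AgreeMap m θv θt ε :=
  fun t T k h1 h2 => (h t T k h1 h2).mono hmn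

theorem AgreeMap.shift {n : ℕ} {θv : ℕ → Option ℕ} {θt : ℕ → Option TyExpr} {ε : Env}
    (h : AgreeMap n θv θt ε) {k : ℕ} {ε' : Env} (hε : ∀ n, ε' (n + k) = ε n) :
    AgreeMap n (shiftV θv k) θt ε' := by
  intro t T j h1 h2
  simp only [shiftV, Option.map_eq_some_iff] at h2
  obtain ⟨i, hi, rfl⟩ := h2
  rw [hε]
  exact h t T i h1 hi

/-- The inductive claim. -/
def Claim (σ : TyExpr) : Prop :=
  ∀ (n : ℕ) (θv : ℕ → Option ℕ) (θt : ℕ → Option TyExpr) (ε : Env),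
    GoodMap θv θt ε → Cov θt σ → AgreeMap n θv θt ε →
    (∀ t T k, headV σ = some t → θt t = some T → θv t = some k → Agree (n + 1) T (ε k)) →
    Agree (n + 1) (substAllTy θt σ) (sem (PcaseTm θv θt σ) ε)

theorem Claim.weak {σ : TyExpr} (h : Claim σ) (n : ℕ) (θv : ℕ → Option ℕ)
    (θt : ℕ → Option TyExpr) (ε : Env) (hg : GoodMap θv θt ε) (hc : Cov θt σ)
    (ha : AgreeMap n θv θt ε) : Agree n (substAllTy θt σ) (sem (PcaseTm θv θt σ) ε) := by
  cases n with
  | zero => intro x y z _ _ _ c hc; omega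
  | succ n =>
    exact h n θv θt ε hg hc (ha.mono (Nat.le_succ n)) fun t T k _ h1 h2 => ha t T k h1 h2

theorem claim_all (σ : TyExpr) : Claim σ := by
  induction σ with
  | tvar t =>
    intro n θv θt ε hg hc ha hh
    obtain ⟨T, hT⟩ := hc t (by simp [TyExpr.freeTV])
    obtain ⟨-, k, hk, hE⟩ := hg t T hT
    simp only [substAllTy, PcaseTm, hT, hk, Option.getD_some, sem]
    exact hh t T k rfl hT hk
  | void =>
    intro n θv θt ε hg hc ha hh x y z hx hy hz c _
    rw [El_void hy, El_void hz]
    simp only [PcaseTm, sem, constSem, aps3, aps_empty, mem_pcaseS]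
    simp
  | sum τ ρ ih1 ih2 =>
    intro n θv θt ε hg hc ha hh x y z hx hy hz c hcn
    have c1 : Cov θt τ := fun t ht => hc t (by simp [TyExpr.freeTV, ht])
    have c2 : Cov θt ρ := fun t ht => hc t (by simp [TyExpr.freeTV, ht])
    set η := envCons z (envCons y (envCons x ε)) with hη
    have g : GoodMap (shiftV θv 3) θt η := hg.shift fun _ => rfl
    have a1 := ih1.weak n (shiftV θv 3) θt η g c1 (ha.shift fun _ => rfl)
    have a2 := ih2.weak n (shiftV θv 3) θt η g c2 (ha.shift fun _ => rfl)
    have hP := Pcase_El τ _ _ η g c1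
    have hQ := Pcase_El ρ _ _ η g c2
    change El (.sum (substAllTy θt τ) (substAllTy θt ρ)) y at hy
    change El (.sum (substAllTy θt τ) (substAllTy θt ρ)) z at hz
    have e : aps3 (sem (PcaseTm θv θt (.sum τ ρ)) ε) x y z =
        ifzS (pcS x (sbS y) (sbS z))
          (inj0 (aps3 (sem (PcaseTm (shiftV θv 3) θt τ) η) x (prj0 y) (prj0 z)))
          (inj1 (aps3 (sem (PcaseTm (shiftV θv 3) θt ρ) η) x (prj1 y) (prj1 z))) := by
      conv_lhs => unfold aps3
      rw [PcaseTm]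
      rw [aps_lam hx, aps_lam hy, aps_lam hz]
      exact (sum_body hP hQ hx hy hz).1
    rw [e]
    have hcar : c ∈ pcaseS x y z → c ∈ (tyInterp (.sum (substAllTy θt τ) (substAllTy θt ρ))).carrier :=
      fun h => (El_pcaseS hx hy hz).1 h
    rw [tyInterp_sum, mem_sumP] at hcar
    simp only [ifzS, Set.mem_ofPred_eq, pcS_f, pcS_t hx]
    have y0 := @El_sum_spr0 _ _ _ hy
    have y1 := @El_sum_spr1 _ _ _ hy
    have z0 := @El_sum_spr0 _ _ _ hz
    have z1 := @El_sum_spr1 _ _ _ hz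
    cases c with
    | stag b => cases b <;> simp [inj0, inj1, mem_pcaseS, sbS_f, sbS_t]
    | spr b a =>
      simp only [Pm.sz] at hcn
      have b1 := a1 x _ _ hx (El_prj0 hy) (El_prj0 hz) a (by omega)
      have b2 := a2 x _ _ hx (El_prj1 hy) (El_prj1 hz) a (by omega)
      rw [mem_pcaseS] at b1 b2
      simp only [prj0, prj1, Set.mem_ofPred_eq] at b1 b2
      cases b
      · simp only [inj0, inj1, Set.mem_ofPred_eq, mem_pcaseS, sbS_f, sbS_t]
        simp
        simp only [prj0] at b1 ⊢
        rw [b1]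
        constructor
        · exact fun h => h.2
        · intro h
          refine ⟨?_, h⟩
          rcases h with h | h | h
          · exact Or.inl ⟨y0 h.1, z0 h.2⟩
          · exact Or.inr (Or.inl ⟨h.1, y0 h.2⟩)
          · exact Or.inr (Or.inr ⟨h.1, z0 h.2⟩)
      · simp only [inj0, inj1, Set.mem_ofPred_eq, mem_pcaseS, sbS_f, sbS_t]
        simp
        simp only [prj1] at b2 ⊢
        rw [b2]
        constructor
        · exact fun h => h.2
        · intro h
          refine ⟨?_, h⟩
          rcases h with h | h | h
          · exact Or.inl ⟨y1 h.1, z1 h.2⟩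
          · exact Or.inr (Or.inl ⟨h.1, y1 h.2⟩)
          · exact Or.inr (Or.inr ⟨h.1, z1 h.2⟩)
    | ppr b a =>
      simp [inj0, inj1] at hcar ⊢; exact hcar
    | fn X a =>
      simp [inj0, inj1] at hcar ⊢; exact hcar
  | prod τ ρ ih1 ih2 =>
    intro n θv θt ε hg hc ha hh x y z hx hy hz c hcn
    have c1 : Cov θt τ := fun t ht => hc t (by simp [TyExpr.freeTV, ht])
    have c2 : Cov θt ρ := fun t ht => hc t (by simp [TyExpr.freeTV, ht])
    set η := envCons z (envCons y (envCons x ε)) with hη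
    have g : GoodMap (shiftV θv 3) θt η := hg.shift fun _ => rfl
    have a1 := ih1.weak n (shiftV θv 3) θt η g c1 (ha.shift fun _ => rfl)
    have a2 := ih2.weak n (shiftV θv 3) θt η g c2 (ha.shift fun _ => rfl)
    have hP := Pcase_El τ _ _ η g c1
    have hQ := Pcase_El ρ _ _ η g c2
    change El (.prod (substAllTy θt τ) (substAllTy θt ρ)) y at hy
    change El (.prod (substAllTy θt τ) (substAllTy θt ρ)) z at hz
    have e : aps3 (sem (PcaseTm θv θt (.prod τ ρ)) ε) x y z =
        pairS (aps3 (sem (PcaseTm (shiftV θv 3) θt τ) η) x (fstS y) (fstS z))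
          (aps3 (sem (PcaseTm (shiftV θv 3) θt ρ) η) x (sndS y) (sndS z)) := by
      conv_lhs => unfold aps3
      rw [PcaseTm]
      rw [aps_lam hx, aps_lam hy, aps_lam hz]
      exact (prod_body hP hQ hx hy hz).1
    rw [e]
    have hcar : c ∈ pcaseS x y z → c ∈ (tyInterp (.prod (substAllTy θt τ) (substAllTy θt ρ))).carrier :=
      fun h => (El_pcaseS hx hy hz).1 h
    rw [tyInterp_prod] at hcar
    simp only [prodP, pairS, Set.mem_ofPred_eq] at hcar ⊢
    cases c with
    | ppr b a =>
      simp only [Pm.sz] at hcn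
      have b1 := a1 x _ _ hx (El_fst hy) (El_fst hz) a (by omega)
      have b2 := a2 x _ _ hx (El_snd hy) (El_snd hz) a (by omega)
      cases b
      · simp
        rw [b1]; rfl
      · simp
        rw [b2]; rfl
    | stag b => simp at hcar ⊢; exact hcar
    | spr b a => simp at hcar ⊢; exact hcar
    | fn X a => simp at hcar ⊢; exact hcar
  | arrow τ ρ ih1 ih2 =>
    intro n θv θt ε hg hc ha hh x y z hx hy hz c hcn
    have c2 : Cov θt ρ := fun t ht => hc t (by simp [TyExpr.freeTV, ht])
    change El (.arrow (substAllTy θt τ) (substAllTy θt ρ)) y at hy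
    change El (.arrow (substAllTy θt τ) (substAllTy θt ρ)) z at hz
    have e : aps3 (sem (PcaseTm θv θt (.arrow τ ρ)) ε) x y z =
        PrOf (tyInterp (substAllTy θt τ)) fun w =>
          aps3 (sem (PcaseTm (shiftV θv 4) θt ρ) (envCons w (envCons z (envCons y (envCons x ε)))))
            x (aps y w) (aps z w) := by
      conv_lhs => unfold aps3
      rw [PcaseTm]
      rw [aps_lam hx, aps_lam hy, aps_lam hz]
      rfl
    rw [e]
    have hcar : c ∈ pcaseS x y z →
        c ∈ (tyInterp (.arrow (substAllTy θt τ) (substAllTy θt ρ))).carrier :=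
      fun h => (El_pcaseS hx hy hz).1 h
    rw [tyInterp_arrow] at hcar
    have hy' := hy
    have hz' := hz
    unfold El at hy' hz'
    rw [tyInterp_arrow] at hy' hz'
    have key : ∀ X a, a.sz < n → goodList (tyInterp (substAllTy θt τ)) X →
        (a ∈ aps3 (sem (PcaseTm (shiftV θv 4) θt ρ)
          (envCons (downListP (tyInterp (substAllTy θt τ)) X)
            (envCons z (envCons y (envCons x ε)))))
          x (aps y (downListP (tyInterp (substAllTy θt τ)) X))
            (aps z (downListP (tyInterp (substAllTy θt τ)) X)) ↔ Pm.fn X a ∈ pcaseS x y z) := by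
      intro X a han hX
      have hw : El (substAllTy θt τ) (downListP (tyInterp (substAllTy θt τ)) X) :=
        elem_down (PS_tyInterp _) fun x hx y hy => (hX.2 x hx y hy).1
      have a2 := ih2.weak n (shiftV θv 4) θt
        (envCons (downListP (tyInterp (substAllTy θt τ)) X) (envCons z (envCons y (envCons x ε))))
        (hg.shift fun _ => rfl) c2 (ha.shift fun _ => rfl) x _ _ hx (El_aps hy hw) (El_aps hz hw)
        a han
      rw [a2, mem_pcaseS, mem_pcaseS, mem_aps_down (PS_tyInterp _) (PS_tyInterp _) hy' hX,
        mem_aps_down (PS_tyInterp _) (PS_tyInterp _) hz' hX]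
    constructor
    · rintro ⟨X, a, rfl, hX, h⟩
      simp only [Pm.sz] at hcn
      exact (key X a (by omega) hX).1 h
    · intro h
      obtain ⟨X, a, rfl, hX, -⟩ := hcar h
      simp only [Pm.sz] at hcn
      exact ⟨X, a, rfl, hX, (key X a (by omega) hX).2 h⟩
  | mu t τ ih =>
    intro n θv θt ε hg hc ha hh
    have hT := closed_mu hg.closed hc
    have hEl := Pcase_El (.mu t τ) θv θt ε hg hc
    by_cases hd : headV τ = some t
    · have hdeg : Deg (substAllTy θt (.mu t τ)) := by
        simp only [substAllTy, Deg]
        exact Deg_substAllTy τ t _ hd (by simp)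
      have hcar := Deg_carrier hdeg
      have hem : ∀ d, El (substAllTy θt (.mu t τ)) d → d = ∅ := fun d h =>
        Set.subset_eq_empty h.1 hcar
      intro x y z hx hy hz c _
      rw [hem _ (El_aps3 hEl hx hy hz), hem _ (El_pcaseS hx hy hz)]
    · have hGl : El (.arrow (pty (substAllTy θt (.mu t τ))) (pty (substAllTy θt (.mu t τ))))
          (sem (.lam (pty (substAllTy θt (.mu t τ)))
            (PcaseTm (fun s => if s = t then some 0 else shiftV θv 1 s)
              (fun s => if s = t then some (substAllTy θt (.mu t τ)) else θt s) τ)) ε) := by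
        refine El_lam fun d hd => ?_
        exact El_congr (pty_congr (tyInterp_substAll_mu hg.closed t τ).symm)
          (Pcase_El τ _ _ _ (hg.update hT hd) (hc.update _))
      have hfix := (Y_fix _ ε hGl).2
      change sem (PcaseTm θv θt (.mu t τ)) ε = aps _ (sem (PcaseTm θv θt (.mu t τ)) ε) at hfix
      rw [aps_lam hEl] at hfix
      have main : ∀ m, m ≤ n + 1 →
          Agree m (substAllTy θt (.mu t τ)) (sem (PcaseTm θv θt (.mu t τ)) ε) := by
        intro m
        induction m with
        | zero => intro _ x y z _ _ _ c hc; omega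
        | succ m ihm =>
          intro hm
          have hprev := ihm (by omega)
          have step := ih m _ _ _ (hg.update hT hEl) (hc.update _) ?_ ?_
          · rw [hfix]
            intro x y z hx hy hz c hc
            have eqT := tyInterp_substAll_mu hg.closed t τ
            exact step x y z hx (El_congr eqT hy) (El_congr eqT hz) c hc
          · intro s S k h1 h2
            by_cases hst : s = t
            · simp only [hst, if_true, Option.some.injEq] at h1 h2
              subst h1; subst h2
              exact hprev
            · simp only [hst, if_false] at h1 h2
              exact (ha.mono (by omega)).shift (k := 1)
                (ε' := envCons (sem (PcaseTm θv θt (.mu t τ)) ε) ε) (fun _ => rfl) s S k h1 h2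
          · intro s S k hs h1 h2
            have hst : s ≠ t := by rintro rfl; exact hd hs
            simp only [hst, if_false] at h1 h2
            simp only [shiftV, Option.map_eq_some_iff] at h2
            obtain ⟨i, hi, rfl⟩ := h2
            exact (hh s S i (by simp only [headV, if_neg hd]; exact hs) h1 hi).mono hm
      exact main (n + 1) le_rfl

/-- For every type `σ`, the term `Pcase([], σ)` — built
recursively from the parallel conjunction `and = λxy. pcase x y 1` together with
the sequential constants (using the fixed point combinator `Y` at recursive
types) — has the same denotational semantics as the parallel conditional
constant `pcase_σ : bool → σ → σ → σ`.  Hence the parallel case function at every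
type is definable from the parallel and-function and the sequential constants. -/
theorem pcase_definable_from_parallel_and (σ : TyExpr) (hσ : σ.Closed) :
    sem (PcaseTm (fun _ => none) (fun _ => none) σ) botEnv =
      sem (.const (.cpcase .void .void σ)) botEnv := by
  have hg : GoodMap (fun _ => none) (fun _ => none) botEnv := by
    intro t T h; cases h
  have hc : Cov (fun _ => none) σ := by
    intro t ht
    rw [TyExpr.Closed] at hσ
    rw [hσ] at ht
    cases ht
  have ag : ∀ n, Agree n σ (sem (PcaseTm (fun _ => none) (fun _ => none) σ) botEnv) := by
    intro n
    have := (claim_all σ).weak n _ _ _ hg hc (by intro t T k h; cases h)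
    rwa [substAllTy_none] at this
  have hE := Pcase_El σ _ _ _ hg hc
  rw [substAllTy_none] at hE
  have hP : El (pty σ) (constSem (.cpcase .void .void σ)) := El_pcase .void .void σ
  refine El_ext hE hP fun x hx => El_ext (El_aps hE hx) (El_aps hP hx) fun y hy =>
    El_ext (El_aps (El_aps hE hx) hy) (El_aps (El_aps hP hx) hy) fun z hz => ?_
  change aps3 _ x y z = aps3 (constSem _) x y z
  rw [aps3, aps3, aps_pcase hx hy hz]
  ext c
  exact (ag (c.sz + 1)) x y z hx hy hz c (Nat.lt_succ_self _)
end RecLam
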